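/- arXiv:2502.08318 — 2 statements merged into one kernel-verified Lean document; each statement's English description precedes it below -/
import Mathlib

section
/- Let m, n be positive integers with n ≥ 2m, let 0 ≤ s ≤ 2m−1 be an integer, and let φ be the fundamental solution of (−Δ)^m in ℝ^n (φ(x) = c|x|^{2m−n} if n > 2m, φ(x) = c ln(5/|x|) if n = 2m, c = c(m,n) > 0). Let f be a measurable function on B_1 with ∫_{B_1 \ {0}} |x|^s |f(x)| dx < ∞, set ψ(x,y) = φ(x−y) − Σ_{|β| ≤ s−1} ((−y)^β / β!) D^β φ(x), and define N(x) = ∫_{|y| ≤ 1} ψ(x,y) f(y) dy for x ≠ 0. Then N ∈ L¹(B_1) and (−Δ)^m N = f in B_1 \ {0} in the sense of distributions. -/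
open MeasureTheory Metric Real Set
open scoped ENNReal NNReal

noncomputable section

/-- First-order partial derivative in direction `i`. -/
def pderiv1 {n : ℕ} (i : Fin n) (f : EuclideanSpace ℝ (Fin n) → ℝ) :
    EuclideanSpace ℝ (Fin n) → ℝ :=
  fun x => fderiv ℝ f x (EuclideanSpace.single i 1)

/-- The Laplacian `Δf = ∑ ∂²f/∂xᵢ²`. -/
def lap {n : ℕ} (f : EuclideanSpace ℝ (Fin n) → ℝ) : EuclideanSpace ℝ (Fin n) → ℝ :=
  fun x => ∑ i, pderiv1 i (pderiv1 i f) x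

/-- The negative Laplacian `-Δ`. -/
def nlap {n : ℕ} (f : EuclideanSpace ℝ (Fin n) → ℝ) : EuclideanSpace ℝ (Fin n) → ℝ :=
  fun x => -(lap f x)

/-- `(-Δ)^m`, the m-th iterate of the negative Laplacian. -/
def nlapIter {n : ℕ} (m : ℕ) (f : EuclideanSpace ℝ (Fin n) → ℝ) :
    EuclideanSpace ℝ (Fin n) → ℝ :=
  nlap^[m] f

/-- `D^β`, the mixed partial derivative associated to a multi-index `β`. -/
def mderiv {n : ℕ} (β : Fin n → ℕ) (f : EuclideanSpace ℝ (Fin n) → ℝ) :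
    EuclideanSpace ℝ (Fin n) → ℝ :=
  ((List.finRange n).foldr (fun i F => F ∘ (pderiv1 i)^[β i]) id) f

/-- The finset of multi-indices `β` with `|β| ≤ s`. -/
def degLE (n s : ℕ) : Finset (Fin n → ℕ) :=
  (Fintype.piFinset fun _ : Fin n => Finset.range (s+1)).filter fun β => ∑ i, β i ≤ s

/-- The finset of multi-indices `β` with `|β| < s` (i.e. `|β| ≤ s - 1`; empty for `s = 0`). -/
def degLT (n s : ℕ) : Finset (Fin n → ℕ) :=
  (Fintype.piFinset fun _ : Fin n => Finset.range s).filter fun β => ∑ i, β i < s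

/-- Fundamental-solution profile of `(-Δ)^m` on `ℝⁿ`:
`c‖x‖^{2m-n}` for `n > 2m` and `c ln(5/‖x‖)` for `n = 2m`. -/
def fundSol (m n : ℕ) (c : ℝ) : EuclideanSpace ℝ (Fin n) → ℝ :=
  fun x => if n = 2*m then c * Real.log (5 / ‖x‖) else c * ‖x‖ ^ ((2*m : ℤ) - n)

/-- `ψ(x,y) = φ(x-y) - ∑_{|β| ≤ s-1} ((-y)^β/β!) D^β φ(x)`. -/
def psiFun (m n s : ℕ) (c : ℝ) (x y : EuclideanSpace ℝ (Fin n)) : ℝ :=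
  fundSol m n c (x - y) -
    ∑ β ∈ degLT n s,
      ((∏ i, (-(y i)) ^ β i) / ∏ i, ((β i).factorial : ℝ)) * mderiv β (fundSol m n c) x

/-- `N(x) = ∫_{|y| ≤ 1} ψ(x,y) f(y) dy`. -/
def NFun (m n s : ℕ) (c : ℝ) (f : EuclideanSpace ℝ (Fin n) → ℝ)
    (x : EuclideanSpace ℝ (Fin n)) : ℝ :=
  ∫ y in closedBall (0 : EuclideanSpace ℝ (Fin n)) 1, psiFun m n s c x y * f y

/-- The function `g` is smooth at every point of the punctured space. -/
def SmoothOffZero {n : ℕ} (g : EuclideanSpace ℝ (Fin n) → ℝ) : Prop :=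
  ∀ x, x ≠ 0 → ContDiffAt ℝ (⊤ : ℕ∞) g x

lemma contDiffAt_pderiv1 {n : ℕ} {g : EuclideanSpace ℝ (Fin n) → ℝ}
    {x : EuclideanSpace ℝ (Fin n)} (hg : ContDiffAt ℝ (⊤ : ℕ∞) g x) (i : Fin n) :
    ContDiffAt ℝ (⊤ : ℕ∞) (pderiv1 i g) x :=
  (hg.fderiv_right (m := (⊤ : ℕ∞)) (by norm_cast)).clm_apply contDiffAt_const

lemma SmoothOffZero.pderiv1 {n : ℕ} {g : EuclideanSpace ℝ (Fin n) → ℝ} (hg : SmoothOffZero g)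
    (i : Fin n) : SmoothOffZero (pderiv1 i g) :=
  fun x hx => contDiffAt_pderiv1 (hg x hx) i

lemma contDiff_pderiv1 {n : ℕ} {g : EuclideanSpace ℝ (Fin n) → ℝ}
    (hg : ContDiff ℝ (⊤ : ℕ∞) g) (i : Fin n) : ContDiff ℝ (⊤ : ℕ∞) (pderiv1 i g) :=
  contDiff_iff_contDiffAt.2 fun _ => contDiffAt_pderiv1 hg.contDiffAt i

lemma measurable_pderiv1 {n : ℕ} (g : EuclideanSpace ℝ (Fin n) → ℝ) (i : Fin n) :
    Measurable (pderiv1 i g) :=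
  measurable_fderiv_apply_const ℝ g _

lemma pderiv1_comm {n : ℕ} {g : EuclideanSpace ℝ (Fin n) → ℝ}
    {x : EuclideanSpace ℝ (Fin n)} (hg : ContDiffAt ℝ (⊤ : ℕ∞) g x) (i j : Fin n) :
    pderiv1 i (pderiv1 j g) x = pderiv1 j (pderiv1 i g) x := by
  have hd : DifferentiableAt ℝ (fderiv ℝ g) x :=
    (hg.fderiv_right (m := (⊤ : ℕ∞)) (by norm_cast)).differentiableAt (by simp)
  have key : ∀ k l : Fin n, pderiv1 k (pderiv1 l g) x =
      fderiv ℝ (fderiv ℝ g) x (EuclideanSpace.single k 1) (EuclideanSpace.single l 1) := by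
    intro k l
    change fderiv ℝ (fun y => fderiv ℝ g y (EuclideanSpace.single l 1)) x _ = _
    rw [fderiv_clm_apply hd (by fun_prop)]
    simp
  rw [key, key]
  exact hg.isSymmSndFDerivAt
    (by simp only [minSmoothness_of_isRCLikeNormedField]; norm_cast) _ _

/-! ### Iterated partial derivatives off the origin -/

lemma pderiv1_congr {n : ℕ} {g h : EuclideanSpace ℝ (Fin n) → ℝ} (H : EqOn g h {0}ᶜ) (i : Fin n) :
    EqOn (pderiv1 i g) (pderiv1 i h) {0}ᶜ := by
  intro x hx
  have : g =ᶠ[nhds x] h := H.eventuallyEq_of_mem (isOpen_compl_singleton.mem_nhds hx)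
  simp only [pderiv1, this.fderiv_eq]

lemma pderiv1_iterate_congr {n : ℕ} {g h : EuclideanSpace ℝ (Fin n) → ℝ} (H : EqOn g h {0}ᶜ)
    (i : Fin n) (k : ℕ) : EqOn ((pderiv1 i)^[k] g) ((pderiv1 i)^[k] h) {0}ᶜ := by
  induction k with
  | zero => exact H
  | succ k ih => simp only [Function.iterate_succ_apply']; exact pderiv1_congr ih i

lemma SmoothOffZero.pderiv1_iterate {n : ℕ} {g : EuclideanSpace ℝ (Fin n) → ℝ}
    (hg : SmoothOffZero g) (i : Fin n) (k : ℕ) : SmoothOffZero ((_root_.pderiv1 i)^[k] g) := by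
  induction k with
  | zero => exact hg
  | succ k ih => rw [Function.iterate_succ_apply']; exact ih.pderiv1 i

lemma SmoothOffZero.pderiv1_iterate_comm {n : ℕ} {g : EuclideanSpace ℝ (Fin n) → ℝ}
    (hg : SmoothOffZero g) (i j : Fin n) (k : ℕ) :
    EqOn ((_root_.pderiv1 j)^[k] (_root_.pderiv1 i g)) (_root_.pderiv1 i ((_root_.pderiv1 j)^[k] g))
      {0}ᶜ := by
  induction k with
  | zero => exact fun _ _ => rfl
  | succ k ih =>
    simp only [Function.iterate_succ_apply']
    exact (pderiv1_congr ih j).trans fun x hx => pderiv1_comm (hg.pderiv1_iterate j k x hx) j i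

/-- The partial derivative `D^β` restricted to the coordinates in the list `l`. -/
def listDeriv {n : ℕ} (l : List (Fin n)) (β : Fin n → ℕ) (f : EuclideanSpace ℝ (Fin n) → ℝ) :
    EuclideanSpace ℝ (Fin n) → ℝ :=
  (l.foldr (fun i F => F ∘ (pderiv1 i)^[β i]) id) f

lemma listDeriv_cons {n : ℕ} (j : Fin n) (l : List (Fin n)) (β : Fin n → ℕ)
    (f : EuclideanSpace ℝ (Fin n) → ℝ) :
    listDeriv (j :: l) β f = listDeriv l β ((pderiv1 j)^[β j] f) := rfl

lemma listDeriv_congr {n : ℕ} (l : List (Fin n)) (β : Fin n → ℕ)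
    {g h : EuclideanSpace ℝ (Fin n) → ℝ} (H : EqOn g h {0}ᶜ) :
    EqOn (listDeriv l β g) (listDeriv l β h) {0}ᶜ := by
  induction l generalizing g h with
  | nil => exact H
  | cons j l ih => exact ih (pderiv1_iterate_congr H j _)

lemma SmoothOffZero.listDeriv_pderiv1 {n : ℕ} (l : List (Fin n)) (β : Fin n → ℕ) (i : Fin n)
    {g : EuclideanSpace ℝ (Fin n) → ℝ} (hg : SmoothOffZero g) :
    EqOn (listDeriv l β (_root_.pderiv1 i g)) (_root_.pderiv1 i (listDeriv l β g)) {0}ᶜ := by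
  induction l generalizing g with
  | nil => exact fun _ _ => rfl
  | cons j l ih =>
    simp only [listDeriv_cons]
    exact (listDeriv_congr l β (hg.pderiv1_iterate_comm i j _)).trans
      (ih (hg.pderiv1_iterate j _))

lemma listDeriv_add_single_of_notMem {n : ℕ} {l : List (Fin n)} (β : Fin n → ℕ) {i : Fin n}
    (hi : i ∉ l) (g : EuclideanSpace ℝ (Fin n) → ℝ) :
    listDeriv l (β + Pi.single i 1) g = listDeriv l β g := by
  induction l generalizing g with
  | nil => rfl
  | cons j l ih =>
    simp only [List.mem_cons, not_or] at hi
    simp [listDeriv_cons, Pi.single_eq_of_ne (Ne.symm hi.1), ih hi.2]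

lemma SmoothOffZero.listDeriv_add_single {n : ℕ} {l : List (Fin n)} (hl : l.Nodup)
    (β : Fin n → ℕ) {i : Fin n} (hi : i ∈ l) {g : EuclideanSpace ℝ (Fin n) → ℝ}
    (hg : SmoothOffZero g) :
    EqOn (listDeriv l (β + Pi.single i 1) g) (listDeriv l β (_root_.pderiv1 i g)) {0}ᶜ := by
  induction l generalizing g with
  | nil => simp at hi
  | cons j l ih =>
    rw [List.nodup_cons] at hl
    simp only [listDeriv_cons]
    by_cases hij : i = j
    · subst hij
      rw [listDeriv_add_single_of_notMem β hl.1]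
      simp [Function.iterate_succ_apply, EqOn]
    · rw [List.mem_cons, or_iff_right hij] at hi
      have : (β + Pi.single i 1 : Fin n → ℕ) j = β j := by simp [Pi.single_eq_of_ne (Ne.symm hij)]
      rw [this]
      exact (ih hl.2 hi (hg.pderiv1_iterate j _)).trans
        (listDeriv_congr l β (hg.pderiv1_iterate_comm i j _).symm)

lemma SmoothOffZero.pderiv1_mderiv {n : ℕ} {g : EuclideanSpace ℝ (Fin n) → ℝ}
    (hg : SmoothOffZero g) (β : Fin n → ℕ) (i : Fin n) :
    EqOn (_root_.pderiv1 i (mderiv β g)) (mderiv (β + Pi.single i 1) g) {0}ᶜ :=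
  ((hg.listDeriv_add_single (List.nodup_finRange n) β (List.mem_finRange i)).trans
    (hg.listDeriv_pderiv1 _ β i)).symm

lemma mderiv_zero {n : ℕ} (g : EuclideanSpace ℝ (Fin n) → ℝ) : mderiv 0 g = g := by
  have : ∀ l : List (Fin n), listDeriv l 0 g = g := fun l => by
    induction l with
    | nil => rfl
    | cons j l ih => simpa [listDeriv_cons] using ih
  exact this _

/-- A property graded by the number of derivatives, stable under partial derivatives, passes
from `g` to `D^β g`. -/
lemma mderiv_induction {n : ℕ} {P : ℕ → (EuclideanSpace ℝ (Fin n) → ℝ) → Prop}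
    (hP : ∀ k g i, P k g → P (k + 1) (pderiv1 i g)) {g : EuclideanSpace ℝ (Fin n) → ℝ}
    (hg : P 0 g) (β : Fin n → ℕ) : P (∑ i, β i) (mderiv β g) := by
  have iter : ∀ (j : Fin n) (k r : ℕ) g, P k g → P (k + r) ((pderiv1 j)^[r] g) := by
    intro j k r g hg
    induction r with
    | zero => exact hg
    | succ r ih => rw [Function.iterate_succ_apply']; exact hP _ _ _ ih
  have key : ∀ (l : List (Fin n)) k g, P k g → P (k + (l.map β).sum) (listDeriv l β g) := by
    intro l
    induction l with
    | nil => exact fun k g hg => hg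
    | cons j l ih =>
      intro k g hg
      rw [List.map_cons, List.sum_cons, ← add_assoc, listDeriv_cons]
      exact ih _ _ (iter j k _ g hg)
  have := key (List.finRange n) 0 g hg
  rwa [zero_add, ← List.ofFn_eq_map, List.sum_ofFn] at this

lemma SmoothOffZero.mderiv {n : ℕ} {g : EuclideanSpace ℝ (Fin n) → ℝ} (hg : SmoothOffZero g)
    (β : Fin n → ℕ) : SmoothOffZero (mderiv β g) :=
  mderiv_induction (P := fun _ => SmoothOffZero) (fun _ _ i h => h.pderiv1 i) hg β

lemma measurable_mderiv {n : ℕ} {g : EuclideanSpace ℝ (Fin n) → ℝ} (hg : Measurable g)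
    (β : Fin n → ℕ) : Measurable (mderiv β g) :=
  mderiv_induction (P := fun _ => Measurable) (fun _ g i _ => measurable_pderiv1 g i) hg β

/-! ### Test functions and the polyharmonic operator -/

lemma tsupport_pderiv1_subset {n : ℕ} (g : EuclideanSpace ℝ (Fin n) → ℝ) (i : Fin n) :
    tsupport (pderiv1 i g) ⊆ tsupport g :=
  tsupport_fderiv_apply_subset ℝ _

lemma contDiff_nlap {n : ℕ} {η : EuclideanSpace ℝ (Fin n) → ℝ}
    (hη : ContDiff ℝ (⊤ : ℕ∞) η) : ContDiff ℝ (⊤ : ℕ∞) (nlap η) :=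
  (ContDiff.sum fun i _ => contDiff_pderiv1 (contDiff_pderiv1 hη i) i).neg

lemma tsupport_nlap_subset {n : ℕ} (η : EuclideanSpace ℝ (Fin n) → ℝ) :
    tsupport (nlap η) ⊆ tsupport η := by
  refine closure_minimal (fun x hx => ?_) (isClosed_tsupport η)
  by_contra h
  refine hx ?_
  have : ∀ i, pderiv1 i (pderiv1 i η) x = 0 := fun i => image_eq_zero_of_notMem_tsupport
    fun h' => h (tsupport_pderiv1_subset _ i (tsupport_pderiv1_subset _ i h'))
  simp [nlap, lap, this]

lemma contDiff_nlapIter {n : ℕ} {η : EuclideanSpace ℝ (Fin n) → ℝ}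
    (hη : ContDiff ℝ (⊤ : ℕ∞) η) (m : ℕ) : ContDiff ℝ (⊤ : ℕ∞) (nlapIter m η) := by
  induction m with
  | zero => exact hη
  | succ m ih => rw [nlapIter, Function.iterate_succ_apply']; exact contDiff_nlap ih

lemma tsupport_nlapIter_subset {n : ℕ} (η : EuclideanSpace ℝ (Fin n) → ℝ) (m : ℕ) :
    tsupport (nlapIter m η) ⊆ tsupport η := by
  induction m with
  | zero => exact subset_rfl
  | succ m ih =>
    rw [nlapIter, Function.iterate_succ_apply']; exact (tsupport_nlap_subset _).trans ih

lemma pderiv1_nlap {n : ℕ} {η : EuclideanSpace ℝ (Fin n) → ℝ}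
    (hη : ContDiff ℝ (⊤ : ℕ∞) η) (i : Fin n) : pderiv1 i (nlap η) = nlap (pderiv1 i η) := by
  have hcomm : ∀ {g : EuclideanSpace ℝ (Fin n) → ℝ}, ContDiff ℝ (⊤ : ℕ∞) g → ∀ j,
      pderiv1 i (pderiv1 j g) = pderiv1 j (pderiv1 i g) := fun hg j =>
    funext fun x => pderiv1_comm hg.contDiffAt i j
  funext x
  have h1 : pderiv1 i (nlap η) x = -∑ j, pderiv1 i (pderiv1 j (pderiv1 j η)) x := by
    change fderiv ℝ (fun y => -∑ j, pderiv1 j (pderiv1 j η) y) x _ = _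
    rw [fderiv_fun_neg, fderiv_fun_sum fun j _ =>
      (contDiff_pderiv1 (contDiff_pderiv1 hη j) j).contDiffAt.differentiableAt (by simp)]
    simp [pderiv1]
  rw [h1]
  simp only [nlap, lap]
  congr 1
  refine Finset.sum_congr rfl fun j _ => ?_
  rw [hcomm (contDiff_pderiv1 hη j), hcomm hη]

lemma pderiv1_nlapIter {n : ℕ} {η : EuclideanSpace ℝ (Fin n) → ℝ}
    (hη : ContDiff ℝ (⊤ : ℕ∞) η) (i : Fin n) (m : ℕ) :
    pderiv1 i (nlapIter m η) = nlapIter m (pderiv1 i η) := by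
  induction m with
  | zero => rfl
  | succ m ih =>
    have hs : ∀ g : EuclideanSpace ℝ (Fin n) → ℝ, nlapIter (m + 1) g = nlap (nlapIter m g) :=
      fun g => Function.iterate_succ_apply' _ _ _
    rw [hs, hs, pderiv1_nlap (contDiff_nlapIter hη m), ih]

lemma pderiv1_comp_add_right {n : ℕ} (g : EuclideanSpace ℝ (Fin n) → ℝ)
    (y : EuclideanSpace ℝ (Fin n)) (i : Fin n) :
    pderiv1 i (fun x => g (x + y)) = fun x => pderiv1 i g (x + y) := by
  funext x; simp only [pderiv1, fderiv_comp_add_right]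

lemma nlapIter_comp_add_right {n : ℕ} (g : EuclideanSpace ℝ (Fin n) → ℝ)
    (y : EuclideanSpace ℝ (Fin n)) (m : ℕ) :
    nlapIter m (fun x => g (x + y)) = fun x => nlapIter m g (x + y) := by
  induction m with
  | zero => rfl
  | succ m ih =>
    have hs : ∀ g : EuclideanSpace ℝ (Fin n) → ℝ, nlapIter (m + 1) g = nlap (nlapIter m g) :=
      fun g => Function.iterate_succ_apply' _ _ _
    rw [hs, hs, ih]
    funext x
    simp only [nlap, lap, pderiv1_comp_add_right]

lemma SmoothOffZero.integrable_mul {n : ℕ} {g ζ : EuclideanSpace ℝ (Fin n) → ℝ}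
    (hg : SmoothOffZero g) (hζ : Continuous ζ) (hc : HasCompactSupport ζ)
    (h0 : (0 : EuclideanSpace ℝ (Fin n)) ∉ tsupport ζ) : Integrable fun x => g x * ζ x := by
  refine Continuous.integrable_of_hasCompactSupport ?_ hc.mul_left
  refine continuous_iff_continuousAt.2 fun x => ?_
  by_cases hx : x = 0
  · subst hx
    have : (fun x => g x * ζ x) =ᶠ[nhds 0] fun _ => 0 := by
      filter_upwards [notMem_tsupport_iff_eventuallyEq.1 h0] with x hx
      simp [hx]
    exact this.continuousAt
  · exact (hg x hx).continuousAt.mul hζ.continuousAt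

lemma SmoothOffZero.integral_pderiv1_mul {n : ℕ} {g ζ : EuclideanSpace ℝ (Fin n) → ℝ}
    (hg : SmoothOffZero g) (hζ : ContDiff ℝ (⊤ : ℕ∞) ζ) (hc : HasCompactSupport ζ)
    (h0 : (0 : EuclideanSpace ℝ (Fin n)) ∉ tsupport ζ) (i : Fin n) :
    ∫ x, _root_.pderiv1 i g x * ζ x = -∫ x, g x * _root_.pderiv1 i ζ x := by
  rw [eq_neg_iff_add_eq_zero, ← neg_eq_iff_add_eq_zero]
  refine (integral_mul_fderiv_eq_neg_fderiv_mul_of_integrable (f := g) (g := ζ)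
    (v := EuclideanSpace.single i 1) ((hg.pderiv1 i).integrable_mul hζ.continuous hc h0)
    (hg.integrable_mul (contDiff_pderiv1 hζ i).continuous
      (hc.mono' ((subset_tsupport _).trans (tsupport_pderiv1_subset ζ i)))
      fun h => h0 (tsupport_pderiv1_subset ζ i h))
    (hg.integrable_mul hζ.continuous hc h0)
    (fun x hx => (hg x fun h => h0 (h ▸ hx)).differentiableAt (by simp))
    (fun x _ => hζ.contDiffAt.differentiableAt (by simp))).symm

/-- Derivatives of a solution of `(-Δ)^m φ = 0` in the punctured space are again solutions. -/
lemma SmoothOffZero.integral_mderiv_mul_nlapIter {n m : ℕ} {φ : EuclideanSpace ℝ (Fin n) → ℝ}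
    (hφ : SmoothOffZero φ)
    (h : ∀ η : EuclideanSpace ℝ (Fin n) → ℝ, ContDiff ℝ (⊤ : ℕ∞) η → HasCompactSupport η →
      (0 : EuclideanSpace ℝ (Fin n)) ∉ tsupport η → ∫ x, φ x * nlapIter m η x = 0)
    (β : Fin n → ℕ) {η : EuclideanSpace ℝ (Fin n) → ℝ} (hη : ContDiff ℝ (⊤ : ℕ∞) η)
    (hc : HasCompactSupport η) (h0 : (0 : EuclideanSpace ℝ (Fin n)) ∉ tsupport η) :
    ∫ x, _root_.mderiv β φ x * nlapIter m η x = 0 := by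
  refine (mderiv_induction (P := fun _ g => SmoothOffZero g ∧ ∀ η : EuclideanSpace ℝ (Fin n) → ℝ,
    ContDiff ℝ (⊤ : ℕ∞) η → HasCompactSupport η → (0 : EuclideanSpace ℝ (Fin n)) ∉ tsupport η →
      ∫ x, g x * nlapIter m η x = 0) ?_ ⟨hφ, h⟩ β).2 η hη hc h0
  rintro _ g i ⟨hg, H⟩
  refine ⟨hg.pderiv1 i, fun η hη hc h0 => ?_⟩
  rw [hg.integral_pderiv1_mul (contDiff_nlapIter hη m)
    (hc.mono' ((subset_tsupport _).trans (tsupport_nlapIter_subset η m)))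
    (fun h => h0 (tsupport_nlapIter_subset η m h)), pderiv1_nlapIter hη,
    H _ (contDiff_pderiv1 hη i) (hc.mono' ((subset_tsupport _).trans (tsupport_pderiv1_subset η i)))
      (fun h => h0 (tsupport_pderiv1_subset η i h)), neg_zero]

/-! ### Taylor expansion in multi-index form -/

/-- The coefficient `v^β / β!`. -/
def multiCoeff {n : ℕ} (v : Fin n → ℝ) (β : Fin n → ℕ) : ℝ :=
  (∏ i, v i ^ β i) / ∏ i, ((β i).factorial : ℝ)

lemma multiCoeff_add_single {n : ℕ} (v : Fin n → ℝ) (β : Fin n → ℕ) (i : Fin n) :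
    (β i + 1 : ℝ) * multiCoeff v (β + Pi.single i 1) = multiCoeff v β * v i := by
  have h : ∀ γ : Fin n → ℕ, multiCoeff v γ =
      (v i ^ γ i / (γ i).factorial) *
        ∏ j ∈ Finset.univ.erase i, v j ^ γ j / ((γ j).factorial : ℝ) := fun γ => by
    rw [multiCoeff, ← Finset.prod_div_distrib]
    exact (Finset.mul_prod_erase _ (fun j => v j ^ γ j / ((γ j).factorial : ℝ))
      (Finset.mem_univ i)).symm
  have h' : ∏ j ∈ Finset.univ.erase i, v j ^ (β + Pi.single i 1 : Fin n → ℕ) j /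
        (((β + Pi.single i 1 : Fin n → ℕ) j).factorial : ℝ) =
      ∏ j ∈ Finset.univ.erase i, v j ^ β j / ((β j).factorial : ℝ) :=
    Finset.prod_congr rfl fun j hj => by
      simp [Pi.single_eq_of_ne (Finset.ne_of_mem_erase hj)]
  rw [h, h β, h']
  have h1 : ((β i + 1 : ℕ) : ℝ) ≠ 0 := by positivity
  have h2 : ((β i).factorial : ℝ) ≠ 0 := by positivity
  simp only [Pi.add_apply, Pi.single_eq_same, Nat.factorial_succ, pow_succ]
  push_cast at h1 ⊢
  field_simp

lemma abs_multiCoeff_le {n : ℕ} (y : EuclideanSpace ℝ (Fin n)) (β : Fin n → ℕ) :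
    |multiCoeff y β| ≤ ‖y‖ ^ ∑ i, β i := by
  have h1 : (1 : ℝ) ≤ ∏ i, ((β i).factorial : ℝ) :=
    Finset.one_le_prod fun i _ => by exact_mod_cast (β i).factorial_pos
  rw [multiCoeff, abs_div, Finset.abs_prod, abs_of_pos (zero_lt_one.trans_le h1),
    ← Finset.prod_pow_eq_pow_sum]
  refine (div_le_self (Finset.prod_nonneg fun _ _ => abs_nonneg _) h1).trans ?_
  refine Finset.prod_le_prod (fun _ _ => abs_nonneg _) fun i _ => ?_
  rw [abs_pow]
  exact pow_le_pow_left₀ (abs_nonneg _) (PiLp.norm_apply_le y i) _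

lemma sum_piAntidiag_multiCoeff_mul {n : ℕ} (v : Fin n → ℝ) (k : ℕ) (F : (Fin n → ℕ) → ℝ) :
    ∑ β ∈ Finset.piAntidiag Finset.univ k,
        multiCoeff v β * ∑ i, v i * F (β + Pi.single i 1) =
      (k + 1) * ∑ γ ∈ Finset.piAntidiag Finset.univ (k + 1), multiCoeff v γ * F γ := by
  have h : ∀ i : Fin n, ∑ β ∈ Finset.piAntidiag Finset.univ k,
      multiCoeff v β * v i * F (β + Pi.single i 1) =
      ∑ γ ∈ Finset.piAntidiag Finset.univ (k + 1), (γ i : ℝ) * (multiCoeff v γ * F γ) := by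
    intro i
    refine Finset.sum_of_injOn (fun β => β + Pi.single i 1)
      (fun β _ γ _ h => add_right_cancel h) ?_ ?_ ?_
    · intro β hβ
      simp only [Finset.mem_coe, Finset.mem_piAntidiag] at hβ ⊢
      simp [Finset.sum_add_distrib, hβ.1]
    · intro γ hγ hn
      simp only [Finset.mem_piAntidiag] at hγ
      by_cases h0 : γ i = 0
      · simp [h0]
      · refine absurd ⟨γ - Pi.single i 1, ?_, ?_⟩ hn
        · have : γ = (γ - Pi.single i 1) + Pi.single i 1 := by
            funext j
            by_cases hj : j = i
            · subst hj; simp; omega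
            · simp [hj]
          have hs := hγ.1
          rw [this] at hs
          simp [Finset.sum_add_distrib] at hs
          simp [hs]
        · funext j
          by_cases hj : j = i
          · subst hj; simp; omega
          · simp [hj]
    · intro β _
      simp only [← multiCoeff_add_single, Pi.add_apply, Pi.single_eq_same]
      push_cast
      ring
  simp only [Finset.mul_sum, ← mul_assoc]
  rw [Finset.sum_comm]
  simp only [h]
  rw [Finset.sum_comm]
  refine Finset.sum_congr rfl fun γ hγ => ?_
  rw [← Finset.sum_mul, ← Nat.cast_sum, (Finset.mem_piAntidiag.1 hγ).1]
  push_cast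
  ring

/-- The homogeneous part of degree `k` in the Taylor expansion of `φ` at `z`. -/
def taylorTerm {n : ℕ} (φ : EuclideanSpace ℝ (Fin n) → ℝ) (k : ℕ)
    (z v : EuclideanSpace ℝ (Fin n)) : ℝ :=
  ∑ β ∈ Finset.piAntidiag Finset.univ k, multiCoeff v β * mderiv β φ z

lemma taylorTerm_zero {n : ℕ} (φ : EuclideanSpace ℝ (Fin n) → ℝ)
    (z v : EuclideanSpace ℝ (Fin n)) : taylorTerm φ 0 z v = φ z := by
  simp [taylorTerm, multiCoeff, mderiv_zero]

lemma fderiv_apply_eq_sum_pderiv1 {n : ℕ} (g : EuclideanSpace ℝ (Fin n) → ℝ)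
    (z v : EuclideanSpace ℝ (Fin n)) : fderiv ℝ g z v = ∑ i, v i * pderiv1 i g z := by
  conv_lhs => rw [← (EuclideanSpace.basisFun (Fin n) ℝ).sum_repr v]
  simp [pderiv1]

lemma SmoothOffZero.hasDerivAt_taylorTerm {n : ℕ} {φ : EuclideanSpace ℝ (Fin n) → ℝ}
    (hφ : SmoothOffZero φ) (k : ℕ) (x v : EuclideanSpace ℝ (Fin n)) (t : ℝ)
    (h : x + t • v ≠ 0) :
    HasDerivAt (fun t => taylorTerm φ k (x + t • v) v)
      ((k + 1) * taylorTerm φ (k + 1) (x + t • v) v) t := by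
  have hl : HasDerivAt (fun t : ℝ => x + t • v) v t := by
    simpa using ((hasDerivAt_id t).smul_const v).const_add x
  rw [taylorTerm, ← sum_piAntidiag_multiCoeff_mul v k fun β => _root_.mderiv β φ (x + t • v)]
  refine HasDerivAt.fun_sum fun β _ => ?_
  have := (((hφ.mderiv β _ h).differentiableAt (by simp)).hasFDerivAt.comp_hasDerivAt t
    hl).const_mul (multiCoeff v β)
  rw [fderiv_apply_eq_sum_pderiv1] at this
  simp only [hφ.pderiv1_mderiv β _ h] at this
  exact this

/-- Taylor's inequality along a segment avoiding the origin. -/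
lemma SmoothOffZero.abs_sub_sum_taylorTerm_le {n s : ℕ} {φ : EuclideanSpace ℝ (Fin n) → ℝ}
    (hφ : SmoothOffZero φ) (hs : 0 < s) {x v : EuclideanSpace ℝ (Fin n)} {M : ℝ}
    (h0 : ∀ t ∈ Icc (0 : ℝ) 1, x + t • v ≠ 0)
    (hM : ∀ t ∈ Icc (0 : ℝ) 1, |taylorTerm φ s (x + t • v) v| ≤ M) :
    |φ (x + v) - ∑ k ∈ Finset.range s, taylorTerm φ k x v| ≤ s * M := by
  set T : ℕ → ℝ → ℝ := fun k t => taylorTerm φ k (x + t • v) v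
  have hd : ∀ t ∈ Icc (0 : ℝ) 1, HasDerivAt (fun t => ∑ k ∈ Finset.range s, (1 - t) ^ k * T k t)
      (s * (1 - t) ^ (s - 1) * T s t) t := by
    intro t ht
    have key : ∑ k ∈ Finset.range s, ((((k + 1 : ℕ) : ℝ) * (1 - t) ^ (k + 1 - 1) * T (k + 1) t) -
        ((k : ℝ) * (1 - t) ^ (k - 1) * T k t)) = s * (1 - t) ^ (s - 1) * T s t := by
      rw [Finset.sum_range_sub fun k : ℕ => (k : ℝ) * (1 - t) ^ (k - 1) * T k t]
      simp
    rw [← key]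
    refine HasDerivAt.fun_sum fun k _ => ?_
    have h1 : HasDerivAt (fun t : ℝ => (1 - t) ^ k) ((k : ℝ) * (1 - t) ^ (k - 1) * (-1)) t :=
      ((hasDerivAt_id t).const_sub 1).pow k
    refine (h1.mul (hφ.hasDerivAt_taylorTerm k x v t (h0 t ht))).congr_deriv ?_
    simp only [T, Nat.add_sub_cancel]
    push_cast
    ring
  have := norm_image_sub_le_of_norm_deriv_le_segment_01' (C := s * M)
    (fun t ht => (hd t ht).hasDerivWithinAt) fun t ht => by
      have ht' := Ico_subset_Icc_self ht
      rw [norm_mul, norm_mul, Real.norm_natCast, mul_assoc]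
      refine mul_le_mul_of_nonneg_left ?_ (Nat.cast_nonneg s)
      calc ‖(1 - t) ^ (s - 1)‖ * ‖T s t‖ ≤ 1 * M := by
            refine mul_le_mul ?_ (hM t ht') (norm_nonneg _) zero_le_one
            rw [norm_pow]
            refine pow_le_one₀ (norm_nonneg _) ?_
            rw [Real.norm_eq_abs, abs_le]
            constructor <;> linarith [ht'.1, ht'.2]
        _ = M := one_mul M
  have h1 : ∑ k ∈ Finset.range s, ((1 : ℝ) - 1) ^ k * T k 1 = φ (x + v) := by
    rw [Finset.sum_eq_single_of_mem 0 (by simpa using hs) fun k _ hk => by simp [hk]]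
    simp [T, taylorTerm_zero]
  rw [h1] at this
  simpa [T] using this

lemma sum_degLT {n s : ℕ} (F : (Fin n → ℕ) → ℝ) :
    ∑ β ∈ degLT n s, F β = ∑ k ∈ Finset.range s, ∑ β ∈ Finset.piAntidiag Finset.univ k, F β := by
  rw [← Finset.sum_fiberwise_of_maps_to (s := degLT n s) (t := Finset.range s)
    (g := fun β => ∑ i, β i) fun β hβ => by simpa using (Finset.mem_filter.1 hβ).2]
  refine Finset.sum_congr rfl fun k hk => Finset.sum_congr ?_ fun _ _ => rfl
  ext β
  simp only [degLT, Finset.mem_filter, Fintype.mem_piFinset, Finset.mem_range,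
    Finset.mem_piAntidiag, Finset.mem_univ, implies_true, and_true]
  have hks := Finset.mem_range.1 hk
  refine ⟨fun h => h.2, fun h => ?_⟩
  have h' : ∑ i, β i = k := h
  refine ⟨⟨fun i => ?_, by omega⟩, h'⟩
  have := Finset.single_le_sum (f := β) (fun _ _ => Nat.zero_le _) (Finset.mem_univ i)
  omega

lemma psiFun_eq_sub_sum_taylorTerm (m n s : ℕ) (c : ℝ) (x y : EuclideanSpace ℝ (Fin n)) :
    psiFun m n s c x y =
      fundSol m n c (x + -y) - ∑ k ∈ Finset.range s, taylorTerm (fundSol m n c) k x (-y) := by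
  simp only [psiFun, taylorTerm]
  rw [← sum_degLT fun β => multiCoeff (-y) β * mderiv β (fundSol m n c) x, sub_eq_add_neg x y]
  simp [multiCoeff]

/-! ### Homogeneity and growth of the derivatives -/

/-- If `g` is positively homogeneous of degree `d` off the origin, up to additive constants, then
`D^β g` with `β ≠ 0` grows at most like `‖x‖ ^ (d - |β|)`. -/
lemma SmoothOffZero.abs_mderiv_le {n : ℕ} {g : EuclideanSpace ℝ (Fin n) → ℝ} {d : ℝ}
    (hg : SmoothOffZero g)
    (hd : ∀ r > 0, ∃ K, ∀ x ≠ 0, g (r • x) = r ^ d * g x + K)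
    {β : Fin n → ℕ} (hβ : 0 < ∑ i, β i) :
    ∃ C ≥ 0, ∀ x ≠ 0, |_root_.mderiv β g x| ≤ C * ‖x‖ ^ (d - (∑ i, β i : ℕ)) := by
  have H : ∀ r > 0, ∃ K, (0 < ∑ i, β i → K = 0) ∧
      ∀ x ≠ 0, _root_.mderiv β g (r • x) =
        r ^ (d - (∑ i, β i : ℕ)) * _root_.mderiv β g x + K := by
    refine (mderiv_induction (P := fun k g => SmoothOffZero g ∧ ∀ r > 0, ∃ K, (0 < k → K = 0) ∧
      ∀ x ≠ 0, g (r • x) = r ^ (d - k) * g x + K) ?_ ⟨hg, fun r hr => ?_⟩ β).2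
    · rintro k g i ⟨hg, H⟩
      refine ⟨hg.pderiv1 i, fun r hr => ⟨0, fun _ => rfl, fun x hx => ?_⟩⟩
      obtain ⟨K, -, hK⟩ := H r hr
      have e : EqOn (fun x => g (r • x)) (fun x => r ^ (d - k) * g x + K) {0}ᶜ :=
        fun x hx => hK x hx
      have e' := pderiv1_congr e i hx
      have h1 : _root_.pderiv1 i (fun x => g (r • x)) x = r * _root_.pderiv1 i g (r • x) := by
        simp only [_root_.pderiv1]
        rw [fderiv_comp_smul]
        simp
      have h2 : _root_.pderiv1 i (fun x => r ^ (d - k) * g x + K) x =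
          r ^ (d - k) * _root_.pderiv1 i g x := by
        simp only [_root_.pderiv1]
        rw [fderiv_add_const, fderiv_const_mul ((hg x hx).differentiableAt (by simp))]
        simp
      rw [h1, h2] at e'
      have h3 : r ^ (d - k) = r * r ^ (d - (k + 1 : ℕ)) := by
        conv_rhs => rw [← Real.rpow_one r, ← Real.rpow_mul hr.le, ← Real.rpow_add hr]
        congr 1
        push_cast
        ring
      rw [h3, mul_assoc] at e'
      rw [mul_left_cancel₀ hr.ne' e', add_zero]
    · obtain ⟨K, hK⟩ := hd r hr
      exact ⟨K, by simp, by simpa using hK⟩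
  obtain ⟨C, hC⟩ := (isCompact_sphere (0 : EuclideanSpace ℝ (Fin n)) 1).exists_bound_of_continuousOn
    (f := _root_.mderiv β g) fun x hx => ((hg.mderiv β) x (by
      rintro rfl; simp at hx)).continuousAt.continuousWithinAt
  refine ⟨max C 0, le_max_right _ _, fun x hx => ?_⟩
  have hr : 0 < ‖x‖ := norm_pos_iff.2 hx
  obtain ⟨K, hK0, hK⟩ := H ‖x‖ hr
  have hK' := hK (‖x‖⁻¹ • x) (by simp [hx])
  rw [smul_inv_smul₀ hr.ne', hK0 hβ, add_zero] at hK'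
  rw [hK', abs_mul, abs_of_nonneg (Real.rpow_nonneg hr.le _), mul_comm]
  refine mul_le_mul_of_nonneg_right ((hC _ ?_).trans (le_max_left _ _)) (Real.rpow_nonneg hr.le _)
  simp [norm_smul, hr.ne']

/-! ### The fundamental solution -/

lemma smoothOffZero_fundSol (m n : ℕ) (c : ℝ) : SmoothOffZero (fundSol m n c) := by
  intro x hx
  have hx' : ‖x‖ ≠ 0 := norm_ne_zero_iff.2 hx
  have hn : ContDiffAt ℝ (⊤ : ℕ∞) (fun x : EuclideanSpace ℝ (Fin n) => ‖x‖) x :=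
    contDiffAt_norm ℝ hx
  unfold fundSol
  split_ifs
  · exact contDiffAt_const.mul ((contDiffAt_const.div hn hx').log (div_ne_zero (by norm_num) hx'))
  · have : (fun x : EuclideanSpace ℝ (Fin n) => c * ‖x‖ ^ ((2*m : ℤ) - n)) =
        fun x => c * ‖x‖ ^ (((2*m : ℤ) - n : ℤ) : ℝ) := by
      simp only [Real.rpow_intCast]
    rw [this]
    exact contDiffAt_const.mul (hn.rpow_const_of_ne hx')

lemma measurable_fundSol (m n : ℕ) (c : ℝ) : Measurable (fundSol m n c) := by
  unfold fundSol
  split_ifs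
  · fun_prop
  · have : (fun x : EuclideanSpace ℝ (Fin n) => c * ‖x‖ ^ ((2*m : ℤ) - n)) =
        fun x => c * ‖x‖ ^ (((2*m : ℤ) - n : ℤ) : ℝ) := by
      simp only [Real.rpow_intCast]
    rw [this]
    fun_prop

lemma fundSol_of_ne {m n : ℕ} (h : n ≠ 2 * m) (c : ℝ) (x : EuclideanSpace ℝ (Fin n)) :
    fundSol m n c x = c * ‖x‖ ^ (2 * m - n : ℝ) := by
  rw [fundSol, if_neg h, ← Real.rpow_intCast]
  push_cast
  rfl

lemma fundSol_smul (m n : ℕ) (c : ℝ) {r : ℝ} (hr : 0 < r) :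
    ∃ K, ∀ x ≠ 0, fundSol m n c (r • x) = r ^ (2 * m - n : ℝ) * fundSol m n c x + K := by
  by_cases h : n = 2 * m
  · refine ⟨-(c * Real.log r), fun x hx => ?_⟩
    have hx' : ‖x‖ ≠ 0 := norm_ne_zero_iff.2 hx
    have h0 : (2 * m - n : ℝ) = 0 := by rw [h]; push_cast; ring
    rw [h0, Real.rpow_zero, fundSol, fundSol, if_pos h, if_pos h, norm_smul,
      Real.norm_of_nonneg hr.le, Real.log_div (by norm_num) (by positivity),
      Real.log_div (by norm_num) hx',
      Real.log_mul hr.ne' hx']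
    ring
  · refine ⟨0, fun x hx => ?_⟩
    rw [fundSol_of_ne h, fundSol_of_ne h, norm_smul, Real.norm_of_nonneg hr.le,
      Real.mul_rpow hr.le (norm_nonneg _)]
    ring

lemma fundSol_abs_le (m n : ℕ) (c : ℝ) :
    ∃ C ≥ 0, ∀ x : EuclideanSpace ℝ (Fin n), x ≠ 0 → ‖x‖ ≤ 2 →
      |fundSol m n c x| ≤ C * ‖x‖ ^ (2 * m - n - 1 / 2 : ℝ) := by
  by_cases h : n = 2 * m
  · refine ⟨|c| * (5 ^ (1 / 2 : ℝ) / (1 / 2)), by positivity, fun x hx hx2 => ?_⟩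
    have hx' : 0 < ‖x‖ := norm_pos_iff.2 hx
    have h0 : (2 * m - n - 1 / 2 : ℝ) = -(1 / 2) := by rw [h]; push_cast; ring
    rw [fundSol, if_pos h, abs_mul, h0, mul_assoc]
    refine mul_le_mul_of_nonneg_left ?_ (abs_nonneg c)
    rw [abs_of_nonneg (Real.log_nonneg (by rw [le_div_iff₀ hx']; linarith))]
    refine (Real.log_le_rpow_div (by positivity) (by norm_num : (0 : ℝ) < 1 / 2)).trans_eq ?_
    rw [Real.div_rpow (by norm_num) hx'.le, Real.rpow_neg hx'.le]
    ring
  · refine ⟨|c| * 2 ^ (1 / 2 : ℝ), by positivity, fun x hx hx2 => ?_⟩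
    have hx' : 0 < ‖x‖ := norm_pos_iff.2 hx
    rw [fundSol_of_ne h, abs_mul, abs_of_nonneg (Real.rpow_nonneg hx'.le _), mul_assoc]
    refine mul_le_mul_of_nonneg_left ?_ (abs_nonneg c)
    calc ‖x‖ ^ (2 * m - n : ℝ) = ‖x‖ ^ (1 / 2 : ℝ) * ‖x‖ ^ (2 * m - n - 1 / 2 : ℝ) := by
          rw [← Real.rpow_add hx']; congr 1; ring
      _ ≤ _ := mul_le_mul_of_nonneg_right (Real.rpow_le_rpow hx'.le hx2 (by norm_num))
          (Real.rpow_nonneg hx'.le _)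

lemma mderiv_fundSol_abs_le (m n : ℕ) (c : ℝ) (β : Fin n → ℕ) :
    ∃ C ≥ 0, ∀ x : EuclideanSpace ℝ (Fin n), x ≠ 0 → ‖x‖ ≤ 2 →
      |mderiv β (fundSol m n c) x| ≤ C * ‖x‖ ^ (2 * m - n - 1 / 2 - (∑ i, β i : ℕ) : ℝ) := by
  by_cases hβ : 0 < ∑ i, β i
  · obtain ⟨C, hC0, hC⟩ := (smoothOffZero_fundSol m n c).abs_mderiv_le
      (fun r hr => fundSol_smul m n c hr) hβ
    refine ⟨C * 2 ^ (1 / 2 : ℝ), by positivity, fun x hx hx2 => (hC x hx).trans ?_⟩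
    have hx' : 0 < ‖x‖ := norm_pos_iff.2 hx
    rw [mul_assoc]
    refine mul_le_mul_of_nonneg_left ?_ hC0
    calc ‖x‖ ^ (2 * m - n - (∑ i, β i : ℕ) : ℝ) =
          ‖x‖ ^ (1 / 2 : ℝ) * ‖x‖ ^ (2 * m - n - 1 / 2 - (∑ i, β i : ℕ) : ℝ) := by
          rw [← Real.rpow_add hx']; congr 1; ring
      _ ≤ _ := mul_le_mul_of_nonneg_right (Real.rpow_le_rpow hx'.le hx2 (by norm_num))
          (Real.rpow_nonneg hx'.le _)
  · have h0 : β = 0 := by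
      funext i
      have := Finset.single_le_sum (f := β) (fun _ _ => Nat.zero_le _) (Finset.mem_univ i)
      simp only [Pi.zero_apply]
      omega
    subst h0
    simpa [mderiv_zero] using fundSol_abs_le m n c

/-- Far from the singularity, `ψ` is controlled by the Taylor remainder. -/
lemma psiFun_abs_le_far (m n s : ℕ) (hs : 0 < s) (hm : 2 * m ≤ n) (c : ℝ) :
    ∃ C ≥ 0, ∀ x y : EuclideanSpace ℝ (Fin n), x ≠ 0 → ‖x‖ ≤ 1 → 2 * ‖y‖ ≤ ‖x‖ →
      |psiFun m n s c x y| ≤ C * (‖y‖ ^ s * ‖x‖ ^ (2 * m - n - s - 1 / 2 : ℝ)) := by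
  have hφ := smoothOffZero_fundSol m n c
  have hb : ∀ β : Fin n → ℕ, ∃ C ≥ 0, β ∈ Finset.piAntidiag Finset.univ s →
      ∀ x ≠ 0, |mderiv β (fundSol m n c) x| ≤ C * ‖x‖ ^ (2 * m - n - s : ℝ) := by
    intro β
    by_cases h : ∑ i, β i = s
    · obtain ⟨C, hC0, hC⟩ := hφ.abs_mderiv_le (fun r hr => fundSol_smul m n c hr)
        (β := β) (by omega)
      rw [h] at hC
      exact ⟨C, hC0, fun _ => hC⟩
    · exact ⟨0, le_rfl, fun h' => absurd (Finset.mem_piAntidiag.1 h').1 h⟩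
  choose C hC0 hC using hb
  set e : ℝ := 2 * m - n - s
  have he : e ≤ 0 := by
    have : (2 * m : ℝ) ≤ n := by exact_mod_cast hm
    have : (0 : ℝ) ≤ s := Nat.cast_nonneg s
    simp only [e]; linarith
  set A := ∑ β ∈ Finset.piAntidiag Finset.univ s, C β
  have hA : 0 ≤ A := Finset.sum_nonneg fun β _ => hC0 β
  refine ⟨s * (A * (1 / 2) ^ e), by positivity, fun x y hx hx1 hxy => ?_⟩
  have hx' : 0 < ‖x‖ := norm_pos_iff.2 hx
  have hseg : ∀ t ∈ Icc (0 : ℝ) 1, 1 / 2 * ‖x‖ ≤ ‖x + t • -y‖ := by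
    intro t ht
    have h1 : ‖t • -y‖ ≤ ‖y‖ := by
      rw [norm_smul, norm_neg, Real.norm_of_nonneg ht.1]
      exact mul_le_of_le_one_left (norm_nonneg _) ht.2
    have h2 := norm_sub_norm_le x (-(t • -y))
    rw [norm_neg, sub_neg_eq_add] at h2
    linarith
  have hne : ∀ t ∈ Icc (0 : ℝ) 1, x + t • -y ≠ 0 := fun t ht => by
    rw [← norm_pos_iff]; linarith [hseg t ht]
  rw [psiFun_eq_sub_sum_taylorTerm]
  refine (hφ.abs_sub_sum_taylorTerm_le hs hne (M := A * (1 / 2) ^ e * (‖y‖ ^ s * ‖x‖ ^ e))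
    fun t ht => ?_).trans ?_
  · rw [taylorTerm]
    refine (Finset.abs_sum_le_sum_abs _ _).trans ?_
    rw [mul_assoc, Finset.sum_mul]
    refine Finset.sum_le_sum fun β hβ => ?_
    rw [abs_mul]
    have h1 := abs_multiCoeff_le (-y) β
    have hβ' : ∑ i, β i = s := (Finset.mem_piAntidiag.1 hβ).1
    rw [norm_neg, hβ'] at h1
    have h2 := hC β hβ _ (hne t ht)
    have h3 : ‖x + t • -y‖ ^ e ≤ (1 / 2) ^ e * ‖x‖ ^ e := by
      rw [← Real.mul_rpow (by norm_num) hx'.le]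
      exact Real.rpow_le_rpow_of_nonpos (by positivity) (hseg t ht) he
    calc |multiCoeff (-y) β| * |mderiv β (fundSol m n c) (x + t • -y)|
        ≤ ‖y‖ ^ s * (C β * ((1 / 2) ^ e * ‖x‖ ^ e)) :=
          mul_le_mul h1 (h2.trans (mul_le_mul_of_nonneg_left h3 (hC0 β))) (abs_nonneg _)
            (by positivity)
      _ = C β * ((1 / 2) ^ e * (‖y‖ ^ s * ‖x‖ ^ e)) := by ring
  · rw [← mul_assoc]
    gcongr ?_ * (?_ * ?_)
    exact Real.rpow_le_rpow_of_exponent_ge hx' hx1 (by linarith)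

/-- Near the singularity, the terms of `ψ` are controlled one by one. -/
lemma psiFun_abs_le_near (m n s : ℕ) (c : ℝ) :
    ∃ C ≥ 0, ∀ x y : EuclideanSpace ℝ (Fin n), x ≠ 0 → x ≠ y → ‖x‖ ≤ 1 → ‖y‖ ≤ 1 →
      (s = 0 ∨ ‖x‖ ≤ 2 * ‖y‖) → |psiFun m n s c x y| ≤
        C * (‖y‖ ^ s * (‖x‖ ^ (2 * m - n - s - 1 / 2 : ℝ) +
          ‖x - y‖ ^ (2 * m - n - s - 1 / 2 : ℝ))) := by
  obtain ⟨C₀, hC₀, hC₀'⟩ := fundSol_abs_le m n c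
  choose C hC0 hC using mderiv_fundSol_abs_le m n c
  set e : ℝ := 2 * m - n - s - 1 / 2
  set A := ∑ β ∈ degLT n s, C β
  have hA : 0 ≤ A := Finset.sum_nonneg fun β _ => hC0 β
  refine ⟨C₀ * 3 ^ s + A * 2 ^ s, by positivity, fun x y hx hxy hx1 hy1 h => ?_⟩
  have hx' : 0 < ‖x‖ := norm_pos_iff.2 hx
  have hxy' : 0 < ‖x - y‖ := norm_pos_iff.2 (sub_ne_zero.2 hxy)
  have htri := norm_sub_le x y
  have h1 : |fundSol m n c (x - y)| ≤ C₀ * 3 ^ s * (‖y‖ ^ s * ‖x - y‖ ^ e) := by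
    refine (hC₀' _ (sub_ne_zero.2 hxy) (by linarith)).trans ?_
    have : ‖x - y‖ ^ (2 * m - n - 1 / 2 : ℝ) = ‖x - y‖ ^ s * ‖x - y‖ ^ e := by
      rw [← Real.rpow_natCast, ← Real.rpow_add hxy']; congr 1; simp only [e]; ring
    rw [this, mul_assoc, ← mul_assoc (3 ^ s), ← mul_pow]
    gcongr C₀ * (?_ * _)
    rcases h with rfl | h
    · simp
    · exact pow_le_pow_left₀ hxy'.le (by linarith) _
  have h2 : ∀ β ∈ degLT n s,
      |multiCoeff (-y) β * mderiv β (fundSol m n c) x| ≤ C β * (2 ^ s * (‖y‖ ^ s * ‖x‖ ^ e)) := by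
    intro β hβ
    have hβs : ∑ i, β i < s := (Finset.mem_filter.1 hβ).2
    have hxy2 : ‖x‖ ≤ 2 * ‖y‖ := h.resolve_left (by omega)
    set b := ∑ i, β i with hb
    have h3 := abs_multiCoeff_le (-y) β
    rw [norm_neg, ← hb] at h3
    have h4 := hC β x hx (by linarith)
    rw [← hb] at h4
    have h5 : ‖x‖ ^ (2 * m - n - 1 / 2 - b : ℝ) = ‖x‖ ^ (s - b) * ‖x‖ ^ e := by
      rw [← Real.rpow_natCast, ← Real.rpow_add hx', Nat.cast_sub hβs.le]
      congr 1; simp only [e]; ring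
    have h6 : ‖x‖ ^ (s - b) ≤ 2 ^ s * ‖y‖ ^ (s - b) := by
      refine (pow_le_pow_left₀ hx'.le hxy2 _).trans ?_
      rw [mul_pow]
      gcongr
      · norm_num
      · omega
    rw [abs_mul]
    calc |multiCoeff (-y) β| * |mderiv β (fundSol m n c) x|
        ≤ ‖y‖ ^ b * (C β * ((2 ^ s * ‖y‖ ^ (s - b)) * ‖x‖ ^ e)) := by
          refine mul_le_mul h3 (h4.trans ?_) (abs_nonneg _) (by positivity)
          rw [h5]
          have := hC0 β
          gcongr
      _ = C β * (2 ^ s * ((‖y‖ ^ b * ‖y‖ ^ (s - b)) * ‖x‖ ^ e)) := by ring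
      _ = _ := by rw [← pow_add, Nat.add_sub_cancel' hβs.le]
  have h3 : psiFun m n s c x y = fundSol m n c (x - y) -
      ∑ β ∈ degLT n s, multiCoeff (-y) β * mderiv β (fundSol m n c) x := by
    simp [psiFun, multiCoeff]
  rw [h3]
  refine (abs_sub _ _).trans ((add_le_add h1 ((Finset.abs_sum_le_sum_abs _ _).trans
    (Finset.sum_le_sum h2))).trans ?_)
  rw [← Finset.sum_mul]
  have p1 : 0 ≤ C₀ * 3 ^ s * (‖y‖ ^ s * ‖x‖ ^ e) := by positivity
  have p2 : 0 ≤ A * (2 ^ s * (‖y‖ ^ s * ‖x - y‖ ^ e)) := by positivity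
  change _ + A * _ ≤ _
  linarith

lemma psiFun_abs_le (m n s : ℕ) (hm : 2 * m ≤ n) (c : ℝ) :
    ∃ C ≥ 0, ∀ x y : EuclideanSpace ℝ (Fin n), x ≠ 0 → x ≠ y → ‖x‖ ≤ 1 → ‖y‖ ≤ 1 →
      |psiFun m n s c x y| ≤
        C * (‖y‖ ^ s * (‖x‖ ^ (2 * m - n - s - 1 / 2 : ℝ) +
          ‖x - y‖ ^ (2 * m - n - s - 1 / 2 : ℝ))) := by
  obtain ⟨C₁, hC₁, h₁⟩ := psiFun_abs_le_near m n s c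
  rcases Nat.eq_zero_or_pos s with hs | hs
  · exact ⟨C₁, hC₁, fun x y hx hxy hx1 hy1 => h₁ x y hx hxy hx1 hy1 (Or.inl hs)⟩
  obtain ⟨C₂, hC₂, h₂⟩ := psiFun_abs_le_far m n s hs hm c
  refine ⟨max C₁ C₂, hC₁.trans (le_max_left _ _), fun x y hx hxy hx1 hy1 => ?_⟩
  rcases le_total ‖x‖ (2 * ‖y‖) with h | h
  · refine (h₁ x y hx hxy hx1 hy1 (Or.inr h)).trans ?_
    gcongr
    exact le_max_left _ _
  · refine (h₂ x y hx hx1 h).trans ?_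
    gcongr
    · exact le_max_right _ _
    · exact le_add_of_nonneg_right (by positivity)

/-! ### Integrability -/

lemma measurable_psiFun (m n s : ℕ) (c : ℝ) :
    Measurable fun p : EuclideanSpace ℝ (Fin n) × EuclideanSpace ℝ (Fin n) =>
      psiFun m n s c p.1 p.2 := by
  have h : ∀ β, Measurable (mderiv β (fundSol m n c)) :=
    fun β => measurable_mderiv (measurable_fundSol m n c) β
  have h1 := measurable_fundSol m n c
  unfold psiFun
  refine (h1.comp (measurable_fst.sub measurable_snd)).sub
    (Finset.measurable_sum _ fun β _ => Measurable.mul ?_ ((h β).comp measurable_fst))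
  fun_prop

lemma integrable_indicator_rpow {n : ℕ} (hn : 0 < n) {e : ℝ} (he : -n < e) (r : ℝ) :
    Integrable ((ball (0 : EuclideanSpace ℝ (Fin n)) r).indicator fun x => ‖x‖ ^ e) := by
  refine (integrable_indicator_iff measurableSet_ball).2 ?_
  refine integrableOn_ball_of_norm_le_rpow (C := 1) (α := -e) (by simpa using Nat.succ_le_of_lt hn)
    (by simpa using by linarith) (Filter.Eventually.of_forall fun x => ?_) ?_
  · rw [neg_neg, one_mul, Real.norm_of_nonneg (Real.rpow_nonneg (norm_nonneg _) _)]
  · exact (measurable_norm.pow_const e).aestronglyMeasurable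

lemma integrableOn_fundSol {m n : ℕ} (hm : 0 < m) (hn : 0 < n) (c : ℝ) :
    IntegrableOn (fundSol m n c) (ball 0 2) := by
  have : Nontrivial (EuclideanSpace ℝ (Fin n)) :=
    Module.nontrivial_of_finrank_pos (R := ℝ) (by simpa using hn)
  obtain ⟨C, -, hC⟩ := fundSol_abs_le m n c
  have hm' : (1 : ℝ) ≤ m := by exact_mod_cast hm
  refine integrableOn_ball_of_norm_le_rpow (C := C) (α := -(2 * m - n - 1 / 2))
    (by simpa using Nat.succ_le_of_lt hn)
    (by simpa using by linarith) ?_ (measurable_fundSol m n c).aestronglyMeasurable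
  filter_upwards [ae_restrict_mem measurableSet_ball,
    ae_restrict_of_ae (Measure.ae_ne volume (0 : EuclideanSpace ℝ (Fin n)))] with x hx hx0
  rw [neg_neg]
  exact hC x hx0 (mem_ball_zero_iff.1 hx).le

/-- The kernel `ψ(x,y) f(y)` is integrable on the product of the unit balls. -/
lemma integrable_psiFun_mul {m n s : ℕ} (hm : 0 < m) (hn : 2 * m ≤ n) (hs : s ≤ 2 * m - 1) (c : ℝ)
    {f : EuclideanSpace ℝ (Fin n) → ℝ} (hf : Measurable f)
    (hfint : IntegrableOn (fun x => ‖x‖ ^ s * |f x|)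
      (ball (0 : EuclideanSpace ℝ (Fin n)) 1 \ {0})) :
    Integrable (fun p : EuclideanSpace ℝ (Fin n) × EuclideanSpace ℝ (Fin n) =>
        psiFun m n s c p.1 p.2 * f p.2)
      ((volume.restrict (ball 0 1)).prod (volume.restrict (closedBall 0 1))) := by
  have hn0 : 0 < n := by omega
  have : Nontrivial (EuclideanSpace ℝ (Fin n)) :=
    Module.nontrivial_of_finrank_pos (R := ℝ) (by simpa using hn0)
  have h0 : ∀ᵐ x : EuclideanSpace ℝ (Fin n), x ≠ 0 := Measure.ae_ne volume 0
  set e : ℝ := 2 * m - n - s - 1 / 2 with he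
  have hs' : (s : ℝ) + 1 ≤ 2 * m := by exact_mod_cast (by omega : s + 1 ≤ 2 * m)
  set k := (ball (0 : EuclideanSpace ℝ (Fin n)) 2).indicator fun x => ‖x‖ ^ e with hk
  have hkint : Integrable k := integrable_indicator_rpow hn0 (by simp only [he]; linarith) 2
  set h := (closedBall (0 : EuclideanSpace ℝ (Fin n)) 1).indicator fun x => ‖x‖ ^ s * |f x| with hh
  have hhint : Integrable h := by
    refine (integrable_indicator_iff measurableSet_closedBall).2 (hfint.congr_set_ae ?_)
    refine Filter.eventuallyEq_set.2 ?_
    have hsph : ∀ᵐ x : EuclideanSpace ℝ (Fin n), x ∉ sphere (0 : EuclideanSpace ℝ (Fin n)) 1 :=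
      measure_eq_zero_iff_ae_notMem.1 (Measure.addHaar_sphere volume 0 1)
    filter_upwards [h0, hsph] with x hx hx'
    simp only [mem_closedBall_zero_iff, mem_sdiff, mem_ball_zero_iff, mem_singleton_iff, hx,
      not_false_eq_true, and_true, mem_sphere_zero_iff_norm] at hx' ⊢
    exact ⟨fun h => lt_of_le_of_ne h hx', le_of_lt⟩
  obtain ⟨C, hC0, hC⟩ := psiFun_abs_le m n s hn c
  have hG : Integrable (fun p : EuclideanSpace ℝ (Fin n) × EuclideanSpace ℝ (Fin n) =>
      C * (k p.1 * h p.2 + h p.2 * k (p.1 - p.2))) (volume.prod volume) :=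
    ((hkint.mul_prod hhint).add
      (hhint.convolution_integrand (ContinuousLinearMap.mul ℝ ℝ) hkint)).const_mul C
  rw [Measure.prod_restrict]
  refine hG.restrict.mono' ((measurable_psiFun m n s c).mul
    (hf.comp measurable_snd)).aestronglyMeasurable ?_
  filter_upwards [ae_restrict_mem (measurableSet_ball.prod measurableSet_closedBall),
    ae_restrict_of_ae (Measure.quasiMeasurePreserving_fst.ae h0),
    ae_restrict_of_ae ((quasiMeasurePreserving_sub_of_right_invariant volume volume).ae h0)]
    with p hp hp0 hpne
  obtain ⟨x, y⟩ := p
  obtain ⟨hx, hy⟩ := hp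
  simp only [mem_ball_zero_iff, mem_closedBall_zero_iff] at hx hy
  have hxy : ‖x - y‖ < 2 := by linarith [norm_sub_le x y]
  have hb := hC x y hp0 (sub_ne_zero.1 hpne) hx.le hy
  simp only [hk, hh]
  rw [indicator_of_mem (mem_ball_zero_iff.2 (by linarith : ‖x‖ < 2)),
    indicator_of_mem (mem_ball_zero_iff.2 hxy), indicator_of_mem (mem_closedBall_zero_iff.2 hy),
    norm_mul, Real.norm_eq_abs, Real.norm_eq_abs]
  refine (mul_le_mul_of_nonneg_right hb (abs_nonneg (f y))).trans_eq ?_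
  ring

/-! ### The distributional identity for the kernel -/

lemma integral_fundSol_sub_mul_nlapIter {m n : ℕ} {c : ℝ}
    (hfund : ∀ η : EuclideanSpace ℝ (Fin n) → ℝ, ContDiff ℝ (⊤ : ℕ∞) η →
      HasCompactSupport η → ∫ x, fundSol m n c x * nlapIter m η x = η 0)
    {η : EuclideanSpace ℝ (Fin n) → ℝ} (hη : ContDiff ℝ (⊤ : ℕ∞) η) (hc : HasCompactSupport η)
    (y : EuclideanSpace ℝ (Fin n)) :
    ∫ x, fundSol m n c (x - y) * nlapIter m η x = η y := by
  have h := hfund (fun x => η (x + y)) (hη.comp (contDiff_id.add contDiff_const))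
    (hc.comp_homeomorph (Homeomorph.addRight y))
  rw [nlapIter_comp_add_right, ← integral_sub_right_eq_self _ y] at h
  simpa using h

lemma integral_psiFun_mul_nlapIter {m n s : ℕ} (hm : 0 < m) (hn : 0 < n) {c : ℝ}
    (hfund : ∀ η : EuclideanSpace ℝ (Fin n) → ℝ, ContDiff ℝ (⊤ : ℕ∞) η →
      HasCompactSupport η → ∫ x, fundSol m n c x * nlapIter m η x = η 0)
    {η : EuclideanSpace ℝ (Fin n) → ℝ} (hη : ContDiff ℝ (⊤ : ℕ∞) η) (hc : HasCompactSupport η)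
    (hsupp : tsupport η ⊆ ball (0 : EuclideanSpace ℝ (Fin n)) 1 \ {0})
    {y : EuclideanSpace ℝ (Fin n)} (hy : ‖y‖ ≤ 1) :
    ∫ x in ball (0 : EuclideanSpace ℝ (Fin n)) 1, psiFun m n s c x y * nlapIter m η x = η y := by
  have h0 : (0 : EuclideanSpace ℝ (Fin n)) ∉ tsupport η := fun h => (hsupp h).2 rfl
  have hζs := tsupport_nlapIter_subset η m
  have hζc : HasCompactSupport (nlapIter m η) := hc.mono' ((subset_tsupport _).trans hζs)
  have hζ : Continuous (nlapIter m η) := (contDiff_nlapIter hη m).continuous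
  have hout : ∀ x ∉ ball (0 : EuclideanSpace ℝ (Fin n)) 1, nlapIter m η x = 0 := fun x hx =>
    image_eq_zero_of_notMem_tsupport fun h => hx (hsupp (hζs h)).1
  obtain ⟨B, hB⟩ := hζc.exists_bound_of_continuous hζ
  have hφint : Integrable fun x => fundSol m n c (x - y) * nlapIter m η x := by
    have h1 : Integrable fun x => (ball 0 2).indicator (fundSol m n c) (x - y) :=
      ((integrable_indicator_iff measurableSet_ball).2
        (integrableOn_fundSol hm hn c)).comp_sub_right y
    refine (h1.mul_bdd (c := B) hζ.aestronglyMeasurable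
      (Filter.Eventually.of_forall hB)).congr (Filter.Eventually.of_forall fun x => ?_)
    by_cases hx : x ∈ ball (0 : EuclideanSpace ℝ (Fin n)) 1
    · have : x - y ∈ ball (0 : EuclideanSpace ℝ (Fin n)) 2 := by
        rw [mem_ball_zero_iff] at hx ⊢
        linarith [norm_sub_le x y]
      simp only [indicator_of_mem this]
    · simp only [hout x hx, mul_zero]
  have hφ := smoothOffZero_fundSol m n c
  have hdint : ∀ β, Integrable fun x => mderiv β (fundSol m n c) x * nlapIter m η x :=
    fun β => (hφ.mderiv β).integrable_mul hζ hζc fun h => h0 (hζs h)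
  rw [setIntegral_eq_integral_of_forall_compl_eq_zero fun x hx => by rw [hout x hx, mul_zero]]
  simp only [psiFun, sub_mul, Finset.sum_mul, mul_assoc]
  rw [integral_sub hφint (integrable_finsetSum _ fun β _ => (hdint β).const_mul _),
    integral_finsetSum _ fun β _ => (hdint β).const_mul _,
    integral_fundSol_sub_mul_nlapIter hfund hη hc]
  simp only [integral_const_mul]
  rw [Finset.sum_eq_zero, sub_zero]
  intro β _
  rw [hφ.integral_mderiv_mul_nlapIter (fun η hη hc h => ?_) β hη hc h0, mul_zero]
  rw [hfund η hη hc, image_eq_zero_of_notMem_tsupport h]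

/-- `N ∈ L¹(B_1)` and `(-Δ)^m N = f` in `B_1 \ {0}` in the sense of
distributions. -/
theorem stmt_7 (m n s : ℕ) (hm : 0 < m) (hn : 2*m ≤ n) (hs : s ≤ 2*m - 1)
    (c : ℝ) (hc : 0 < c)
    (hfund : ∀ η : EuclideanSpace ℝ (Fin n) → ℝ, ContDiff ℝ (⊤ : ℕ∞) η →
      HasCompactSupport η → ∫ x, fundSol m n c x * nlapIter m η x = η 0)
    (f : EuclideanSpace ℝ (Fin n) → ℝ) (hf : Measurable f)
    (hfint : IntegrableOn (fun x => ‖x‖ ^ s * |f x|)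
      (ball (0 : EuclideanSpace ℝ (Fin n)) 1 \ {0})) :
    IntegrableOn (NFun m n s c f) (ball (0 : EuclideanSpace ℝ (Fin n)) 1) ∧
    ∀ η : EuclideanSpace ℝ (Fin n) → ℝ, ContDiff ℝ (⊤ : ℕ∞) η → HasCompactSupport η →
      tsupport η ⊆ ball (0 : EuclideanSpace ℝ (Fin n)) 1 \ {0} →
      ∫ x in ball (0 : EuclideanSpace ℝ (Fin n)) 1, NFun m n s c f x * nlapIter m η x
        = ∫ x in ball (0 : EuclideanSpace ℝ (Fin n)) 1, f x * η x := by
  have hF := integrable_psiFun_mul hm hn hs c hf hfint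
  refine ⟨hF.integral_prod_left, fun η hη hc hsupp => ?_⟩
  have hζc : HasCompactSupport (nlapIter m η) :=
    hc.mono' ((subset_tsupport _).trans (tsupport_nlapIter_subset η m))
  have hζ : Continuous (nlapIter m η) := (contDiff_nlapIter hη m).continuous
  obtain ⟨B, hB⟩ := hζc.exists_bound_of_continuous hζ
  have hFζ := hF.mul_bdd (c := B) (hζ.comp continuous_fst).aestronglyMeasurable
    (Filter.Eventually.of_forall fun p => hB p.1)
  calc ∫ x in ball (0 : EuclideanSpace ℝ (Fin n)) 1, NFun m n s c f x * nlapIter m η x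
      = ∫ x in ball (0 : EuclideanSpace ℝ (Fin n)) 1,
          ∫ y in closedBall (0 : EuclideanSpace ℝ (Fin n)) 1,
            psiFun m n s c x y * f y * nlapIter m η x := by
        simp only [NFun, integral_mul_const]
    _ = ∫ y in closedBall (0 : EuclideanSpace ℝ (Fin n)) 1,
          ∫ x in ball (0 : EuclideanSpace ℝ (Fin n)) 1,
            psiFun m n s c x y * f y * nlapIter m η x := integral_integral_swap hFζ
    _ = ∫ y in closedBall (0 : EuclideanSpace ℝ (Fin n)) 1, f y * η y := by
        refine setIntegral_congr_fun measurableSet_closedBall fun y hy => ?_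
        simp only [mul_right_comm _ (f y)]
        rw [integral_mul_const, integral_psiFun_mul_nlapIter hm (by omega) hfund hη hc hsupp
          (mem_closedBall_zero_iff.1 hy), mul_comm]
    _ = ∫ x in ball (0 : EuclideanSpace ℝ (Fin n)) 1, f x * η x := by
        refine setIntegral_eq_of_subset_of_forall_sdiff_eq_zero measurableSet_closedBall
          ball_subset_closedBall fun x hx => ?_
        rw [image_eq_zero_of_notMem_tsupport fun h => hx.2 (hsupp h).1, mul_zero]

end
end

section
/- Let m, n be positive integers with n ≥ 2m and B_1 the open unit ball in ℝ^n. Suppose w ∈ L¹_loc(B_1 \ {0}) satisfies (−Δ)^m w = 0 in B_1 \ {0} in the sense of distributions, and suppose ∫_{B_1 \ {0}} w^+(x) dx < ∞, where w^+ = max{w, 0}. Then ∫_{B_1 \ {0}} |w(x)| dx < ∞, i.e. w ∈ L¹(B_1). -/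
open MeasureTheory Metric Real Set
open scoped ENNReal NNReal

noncomputable section

/-- Smooth functions on `ℝ` vanishing outside a compact subinterval of `(-∞, 0)`. -/
def negTest : Submodule ℝ (ℝ → ℝ) where
  carrier := {φ | ContDiff ℝ (⊤ : ℕ∞) φ ∧
    ∃ a b : ℝ, a < b ∧ b < 0 ∧ ∀ t, t ∉ Ioo a b → φ t = 0}
  zero_mem' := ⟨contDiff_const, -2, -1, by norm_num, by norm_num, fun _ _ => rfl⟩
  add_mem' := by
    rintro φ ψ ⟨hφ, a, b, hab, hb, h⟩ ⟨hψ, c, d, hcd, hd, k⟩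
    refine ⟨hφ.add hψ, min a c, max b d, ?_, max_lt hb hd, fun t ht => ?_⟩
    · exact (min_le_left _ _).trans_lt (hab.trans_le (le_max_left _ _))
    · have h1 : t ∉ Ioo a b := fun h' => ht
        ⟨(min_le_left _ _).trans_lt h'.1, h'.2.trans_le (le_max_left _ _)⟩
      have h2 : t ∉ Ioo c d := fun h' => ht
        ⟨(min_le_right _ _).trans_lt h'.1, h'.2.trans_le (le_max_right _ _)⟩
      simp [h t h1, k t h2]
  smul_mem' := by
    rintro c φ ⟨hφ, a, b, hab, hb, h⟩
    exact ⟨hφ.const_smul c, a, b, hab, hb, fun t ht => by simp [h t ht]⟩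

/-- The type of elements of `negTest`. -/
abbrev NegTest : Type := negTest

namespace NegTest

lemma contDiff (φ : NegTest) : ContDiff ℝ (⊤ : ℕ∞) (φ : ℝ → ℝ) := φ.2.1

lemma continuous (φ : NegTest) : Continuous (φ : ℝ → ℝ) := φ.contDiff.continuous

lemma differentiable (φ : NegTest) : Differentiable ℝ (φ : ℝ → ℝ) :=
  φ.contDiff.differentiable (by simp)

lemma exists_Ioo (φ : NegTest) :
    ∃ a b : ℝ, a < b ∧ b < 0 ∧ ∀ t, t ∉ Ioo a b → (φ : ℝ → ℝ) t = 0 := φ.2.2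

lemma eq_zero_of_nonneg (φ : NegTest) {t : ℝ} (ht : 0 ≤ t) : (φ : ℝ → ℝ) t = 0 := by
  obtain ⟨a, b, -, hb, h⟩ := φ.exists_Ioo
  exact h t fun h' => by linarith [h'.2]

lemma hasCompactSupport (φ : NegTest) : HasCompactSupport (φ : ℝ → ℝ) := by
  obtain ⟨a, b, -, -, h⟩ := φ.exists_Ioo
  exact HasCompactSupport.intro isCompact_Icc fun t ht => h t fun h' => ht (Ioo_subset_Icc_self h')

/-- Differentiation on `negTest`. -/
def D : NegTest →ₗ[ℝ] NegTest where
  toFun φ := ⟨deriv φ, (contDiff_infty_iff_deriv.1 φ.contDiff).2, by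
    obtain ⟨a, b, hab, hb, h⟩ := φ.exists_Ioo
    refine ⟨a - 1, b / 2, by linarith, by linarith, fun t ht => ?_⟩
    have : (φ : ℝ → ℝ) =ᶠ[nhds t] fun _ => 0 := by
      have hU : (Icc a b)ᶜ ∈ nhds t := isClosed_Icc.isOpen_compl.mem_nhds fun h' =>
        ht ⟨by linarith [h'.1], by linarith [h'.2]⟩
      filter_upwards [hU] with u hu using h u fun h' => hu (Ioo_subset_Icc_self h')
    simp [this.deriv_eq]⟩
  map_add' φ ψ := by
    ext t
    exact deriv_add φ.differentiable.differentiableAt ψ.differentiable.differentiableAt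
  map_smul' c φ := by
    ext t
    exact deriv_const_smul c φ.differentiable.differentiableAt

/-- Multiplication by `exp (c t)` on `negTest`. -/
def M (c : ℝ) : NegTest →ₗ[ℝ] NegTest where
  toFun φ := ⟨fun t => exp (c * t) * (φ : ℝ → ℝ) t,
    (contDiff_exp.comp (contDiff_const.mul contDiff_id)).mul φ.contDiff, by
    obtain ⟨a, b, hab, hb, h⟩ := φ.exists_Ioo
    exact ⟨a, b, hab, hb, fun t ht => by simp [h t ht]⟩⟩
  map_add' φ ψ := by
    ext t
    simp [mul_add]
  map_smul' d φ := by
    ext t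
    simp [mul_left_comm]

@[simp] lemma D_apply (φ : NegTest) (t : ℝ) : (D φ : ℝ → ℝ) t = deriv φ t := rfl

@[simp] lemma M_apply (c : ℝ) (φ : NegTest) (t : ℝ) :
    (M c φ : ℝ → ℝ) t = exp (c * t) * (φ : ℝ → ℝ) t := rfl

lemma M_M_neg (c : ℝ) (φ : NegTest) : M c (M (-c) φ) = φ := by
  ext t
  simp [← mul_assoc, ← exp_add]

/-- The weighted `L¹` norm `∫ |φ| exp (α t) dt`. -/
def W (α : ℝ) (φ : NegTest) : ℝ := ∫ t, |(φ : ℝ → ℝ) t| * exp (α * t)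

lemma integrable_W (α : ℝ) (φ : NegTest) :
    Integrable fun t => |(φ : ℝ → ℝ) t| * exp (α * t) := by
  refine Continuous.integrable_of_hasCompactSupport ?_ ?_
  · have := φ.continuous
    fun_prop
  · exact φ.hasCompactSupport.abs.mul_right

lemma W_nonneg (α : ℝ) (φ : NegTest) : 0 ≤ W α φ :=
  integral_nonneg fun _ => by positivity

lemma W_M (α c : ℝ) (φ : NegTest) : W α (M c φ) = W (α + c) φ := by
  refine integral_congr_ae (.of_forall fun t => ?_)
  simp only [M_apply, abs_mul, abs_exp, add_mul, exp_add]
  ring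

lemma W_anti {α β : ℝ} (h : α ≤ β) (φ : NegTest) : W β φ ≤ W α φ := by
  refine integral_mono (φ.integrable_W β) (φ.integrable_W α) fun t => ?_
  rcases le_or_gt 0 t with ht | ht
  · simp [φ.eq_zero_of_nonneg ht]
  · have : β * t ≤ α * t := mul_le_mul_of_nonpos_right h ht.le
    dsimp only
    gcongr

/-- The functional `T` is bounded in the weighted `L¹` norm with weight `exp (α t)`. -/
def WBounded (α : ℝ) (T : NegTest →ₗ[ℝ] ℝ) : Prop :=
  ∃ C : ℝ, 0 ≤ C ∧ ∀ φ, |T φ| ≤ C * W α φ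

lemma WBounded.anti {α β : ℝ} {T : NegTest →ₗ[ℝ] ℝ} (h : α ≤ β) (hT : WBounded β T) :
    WBounded α T := by
  obtain ⟨C, hC, hT⟩ := hT
  exact ⟨C, hC, fun φ => (hT φ).trans (mul_le_mul_of_nonneg_left (W_anti h φ) hC)⟩

lemma WBounded.of_M {α c : ℝ} {T : NegTest →ₗ[ℝ] ℝ} (hT : WBounded α (T ∘ₗ M c)) :
    WBounded (α - c) T := by
  obtain ⟨C, hC, hT⟩ := hT
  refine ⟨C, hC, fun φ => ?_⟩
  simpa [M_M_neg, W_M, ← sub_eq_add_neg] using hT (M (-c) φ)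

lemma exists_integral_eq_one : ∃ ρ : NegTest, ∫ t, (ρ : ℝ → ℝ) t = 1 := by
  let b : ContDiffBump (-2 : ℝ) := ⟨1 / 2, 1, by norm_num, by norm_num⟩
  refine ⟨⟨b.normed volume, b.contDiff_normed, -3, -1, by norm_num, by norm_num, ?_⟩,
    b.integral_normed⟩
  intro t ht
  rw [← Function.notMem_support, b.support_normed_eq, Real.ball_eq_Ioo]
  convert ht using 2
  norm_num [b]

lemma exists_primitive (ψ : NegTest) (h0 : ∫ t, (ψ : ℝ → ℝ) t = 0) {α : ℝ} (hα : α < 0) :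
    ∃ f, D f = ψ ∧ W α f ≤ (-α)⁻¹ * W α ψ := by
  obtain ⟨a, b, hab, hb, h⟩ := ψ.exists_Ioo
  have hsupp : ∀ g : ℝ → ℝ, (∀ t, t ∉ Ioo a b → g t = 0) → ∫ t in a..b, g t = ∫ t, g t :=
    fun g hg => intervalIntegral.integral_eq_integral_of_support_subset fun t ht => by
      by_contra hcon
      exact ht (hg t fun h' => hcon (Ioo_subset_Ioc_self h'))
  have hd : ∀ (g : ℝ → ℝ), Continuous g → ∀ t, HasDerivAt (fun t => ∫ u in a..t, g u) (g t) t :=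
    fun g hg t => hg.integral_hasStrictDerivAt a t |>.hasDerivAt
  have hf0 : ∀ t, t ∉ Ioo a b → ∫ u in a..t, (ψ : ℝ → ℝ) u = 0 := by
    intro t ht
    rcases le_or_gt t a with hta | hta
    · refine intervalIntegral.integral_zero_ae (.of_forall fun u hu => h u fun h' => ?_)
      rw [uIoc_of_ge hta] at hu
      exact absurd hu.2 (not_le.2 h'.1)
    · have htb : b ≤ t := by
        by_contra hcon
        exact ht ⟨hta, not_le.1 hcon⟩
      rw [← intervalIntegral.integral_add_adjacent_intervals (b := b)
        (ψ.continuous.intervalIntegrable _ _) (ψ.continuous.intervalIntegrable _ _),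
        hsupp _ h, h0, zero_add]
      refine intervalIntegral.integral_zero_ae (.of_forall fun u hu => h u fun h' => ?_)
      rw [uIoc_of_le htb] at hu
      exact absurd hu.1 (not_lt.2 h'.2.le)
  have hderiv : deriv (fun t => ∫ u in a..t, (ψ : ℝ → ℝ) u) = ψ :=
    funext fun t => (hd _ ψ.continuous t).deriv
  let f : NegTest := ⟨fun t => ∫ u in a..t, (ψ : ℝ → ℝ) u, by
    refine contDiff_infty_iff_deriv.2 ⟨fun t => (hd _ ψ.continuous t).differentiableAt, ?_⟩
    rw [hderiv]
    exact ψ.contDiff, a, b, hab, hb, hf0⟩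
  refine ⟨f, Subtype.ext hderiv, ?_⟩
  set G : ℝ → ℝ := fun t => ∫ u in a..t, |(ψ : ℝ → ℝ) u| with hG
  have hGd : ∀ t, HasDerivAt G |(ψ : ℝ → ℝ) t| t := hd _ ψ.continuous.abs
  have hGc : Continuous G := continuous_iff_continuousAt.2 fun t => (hGd t).continuousAt
  have hψc := ψ.continuous
  have hparts : ∫ t in a..b, (|(ψ : ℝ → ℝ) t| * exp (α * t) + G t * (exp (α * t) * α)) =
      G b * exp (α * b) - G a * exp (α * a) := by
    refine intervalIntegral.integral_eq_sub_of_hasDerivAt (f := fun t => G t * exp (α * t))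
      (fun t _ => ?_) (Continuous.intervalIntegrable (by fun_prop) _ _)
    have he : HasDerivAt (fun t => exp (α * t)) (exp (α * t) * α) t := by
      simpa using ((hasDerivAt_id t).const_mul α).exp
    exact (hGd t).mul he
  rw [intervalIntegral.integral_add (Continuous.intervalIntegrable (by fun_prop) _ _)
    (Continuous.intervalIntegrable (by fun_prop) _ _)] at hparts
  have hGa : G a = 0 := by simp [hG]
  have hGb : 0 ≤ G b := intervalIntegral.integral_nonneg hab.le fun _ _ => abs_nonneg _
  have hα2 : ∫ t in a..b, G t * (exp (α * t) * α) = α * ∫ t in a..b, G t * exp (α * t) := by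
    rw [← intervalIntegral.integral_const_mul]
    congr 1
    ext t
    ring
  have hWψ : ∫ t in a..b, |(ψ : ℝ → ℝ) t| * exp (α * t) = W α ψ :=
    hsupp _ fun t ht => by simp [h t ht]
  have hWf : W α f ≤ ∫ t in a..b, G t * exp (α * t) := by
    rw [W, ← hsupp _ fun t ht => by simp [f, hf0 t ht]]
    have hfc := f.continuous
    refine intervalIntegral.integral_mono_on hab.le
      (Continuous.intervalIntegrable (by fun_prop) _ _)
      (Continuous.intervalIntegrable (by fun_prop) _ _) fun t ht => ?_
    gcongr
    exact intervalIntegral.abs_integral_le_integral_abs ht.1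
  rw [hα2, hWψ, hGa] at hparts
  refine hWf.trans ?_
  rw [← div_eq_inv_mul, le_div_iff₀ (by linarith)]
  nlinarith [mul_nonneg hGb (exp_pos (α * b)).le]

lemma WBounded.of_D {α : ℝ} (hα : α < 0) {T : NegTest →ₗ[ℝ] ℝ} (hT : WBounded α (T ∘ₗ D)) :
    WBounded α T := by
  obtain ⟨C, hC, hT⟩ := hT
  obtain ⟨ρ, hρ⟩ := exists_integral_eq_one
  have hα' : 0 ≤ (-α)⁻¹ := inv_nonneg.2 (by linarith)
  refine ⟨C * ((-α)⁻¹ * (1 + W α ρ)) + |T ρ|, ?_, fun φ => ?_⟩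
  · have := W_nonneg α ρ
    positivity
  set c := ∫ t, (φ : ℝ → ℝ) t with hc
  have hint : ∀ χ : NegTest, Integrable (χ : ℝ → ℝ) := fun χ =>
    χ.continuous.integrable_of_hasCompactSupport χ.hasCompactSupport
  have hcW : |c| ≤ W α φ := by
    refine (abs_integral_le_integral_abs).trans ?_
    simpa [W] using W_anti hα.le φ
  have h0 : ∫ t, ((φ - c • ρ : NegTest) : ℝ → ℝ) t = 0 := by
    have : ∫ t, ((φ : ℝ → ℝ) t - c * (ρ : ℝ → ℝ) t) = 0 := by
      rw [integral_sub (hint φ) ((hint ρ).const_mul c), integral_const_mul, hρ, ← hc]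
      ring
    exact this
  obtain ⟨f, hf, hWf⟩ := exists_primitive _ h0 hα
  have hW : W α (φ - c • ρ) ≤ W α φ + |c| * W α ρ := by
    rw [W, W, W, ← integral_const_mul, ← integral_add (φ.integrable_W α)
      ((ρ.integrable_W α).const_mul _)]
    refine integral_mono (integrable_W α _) ((φ.integrable_W α).add
      ((ρ.integrable_W α).const_mul _)) fun t => ?_
    have h1 : |(φ : ℝ → ℝ) t - c * (ρ : ℝ → ℝ) t| ≤ |(φ : ℝ → ℝ) t| + |c| * |(ρ : ℝ → ℝ) t| := by
      rw [← abs_mul]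
      exact abs_sub _ _
    have h2 := mul_le_mul_of_nonneg_right h1 (exp_pos (α * t)).le
    simp only [Submodule.coe_sub, Submodule.coe_smul, Pi.sub_apply, Pi.smul_apply, smul_eq_mul]
    linarith
  have hsplit : T φ = T (D f) + c * T ρ := by
    rw [hf]
    simp
  have h3 : |T (D f)| ≤ C * ((-α)⁻¹ * (W α φ + |c| * W α ρ)) := by
    refine (hT f).trans (mul_le_mul_of_nonneg_left (hWf.trans ?_) hC)
    exact mul_le_mul_of_nonneg_left hW hα'
  have h4 : C * ((-α)⁻¹ * (W α φ + |c| * W α ρ)) ≤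
      C * ((-α)⁻¹ * (W α φ + W α φ * W α ρ)) := by
    have := W_nonneg α ρ
    gcongr
  have h5 : |c| * |T ρ| ≤ W α φ * |T ρ| := mul_le_mul_of_nonneg_right hcW (abs_nonneg _)
  calc |T φ| ≤ |T (D f)| + |c| * |T ρ| := by
        rw [hsplit, ← abs_mul]
        exact abs_add_le _ _
    _ ≤ _ := by linarith

/-- The negative Laplacian on `ℝⁿ` acting on radial functions, in the variable `log ‖x‖²`. -/
def B (n : ℕ) : NegTest →ₗ[ℝ] NegTest :=
  (-4 : ℝ) • (M (-(n / 2 : ℝ)) ∘ₗ D ∘ₗ M (n / 2 - 1 : ℝ) ∘ₗ D)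

lemma WBounded.of_B {n : ℕ} (hn : 2 ≤ n) {T : NegTest →ₗ[ℝ] ℝ}
    (hT : WBounded (1 / 2) (T ∘ₗ B n)) : WBounded (1 / 2) T := by
  have hn' : (2 : ℝ) ≤ n := by exact_mod_cast hn
  have h1 : WBounded (-1 / 2)
      ((((T ∘ₗ M (-(n / 2 : ℝ))) ∘ₗ D) ∘ₗ M (n / 2 - 1 : ℝ)) ∘ₗ D) := by
    obtain ⟨C, hC, hT⟩ := hT.anti (show (-1 / 2 : ℝ) ≤ 1 / 2 by norm_num)
    refine ⟨C, hC, fun φ => ?_⟩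
    have h := hT φ
    simp only [B, LinearMap.comp_apply, LinearMap.smul_apply, map_smul, smul_eq_mul, abs_mul]
      at h ⊢
    norm_num at h
    linarith [abs_nonneg (T (M (-(n / 2 : ℝ)) (D (M (n / 2 - 1 : ℝ) (D φ)))))]
  have h2 := ((h1.of_D (by norm_num)).of_M.of_D (by linarith)).of_M
  convert h2 using 1
  ring

lemma WBounded.of_B_pow {n : ℕ} (hn : 2 ≤ n) {T : NegTest →ₗ[ℝ] ℝ} (m : ℕ)
    (hT : ∀ φ, T ((B n)^[m] φ) = 0) : WBounded (1 / 2) T := by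
  suffices h : WBounded (1 / 2) (T ∘ₗ (B n ^ m)) by
    clear hT
    induction m with
    | zero => simpa [Module.End.one_eq_id] using h
    | succ k ih => exact ih (WBounded.of_B hn (by rwa [pow_succ, Module.End.mul_eq_comp] at h))
  exact ⟨0, le_rfl, fun φ => by simp [Module.End.pow_apply, hT]⟩

lemma exists_cutoff (k : ℕ) : ∃ χ : NegTest, (∀ t, 0 ≤ (χ : ℝ → ℝ) t) ∧
    (∀ t, (χ : ℝ → ℝ) t ≤ 1) ∧
    ∀ t : ℝ, -(k + 2 : ℝ) ≤ t → t ≤ -(k + 1 : ℝ)⁻¹ → (χ : ℝ → ℝ) t = 1 := by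
  have h1 : (k + 1 : ℝ)⁻¹ ≤ 1 := inv_le_one_of_one_le₀ (by linarith [k.cast_nonneg (α := ℝ)])
  have h2 : (k + 2 : ℝ)⁻¹ < (k + 1 : ℝ)⁻¹ := by
    gcongr
    norm_num
  have h3 : 0 < (k + 2 : ℝ)⁻¹ := by positivity
  have hk := k.cast_nonneg (α := ℝ)
  let b : ContDiffBump (-(k + 2) : ℝ) :=
    ⟨k + 2 - (k + 1 : ℝ)⁻¹, k + 2 - (k + 2 : ℝ)⁻¹, by linarith, by linarith⟩
  refine ⟨⟨b, b.contDiff, -(k + 2) - (k + 2 - (k + 2 : ℝ)⁻¹), -(k + 2 : ℝ)⁻¹, by linarith,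
    by linarith, ?_⟩, fun t => b.nonneg, fun t => b.le_one, fun t ht1 ht2 => ?_⟩
  · intro t ht
    rw [← Function.notMem_support, b.support_eq, Real.ball_eq_Ioo]
    convert ht using 2
    simp only [b]
    ring_nf
  · refine b.one_of_mem_closedBall ?_
    rw [Real.closedBall_eq_Icc]
    exact ⟨by simp only [b]; linarith, by simp only [b]; linarith⟩

lemma W_half_le (φ : NegTest) (h : ∀ t, |(φ : ℝ → ℝ) t| ≤ 1) :
    W (1 / 2) φ ≤ ∫ t in Iic (0 : ℝ), exp (1 / 2 * t) := by
  rw [W, ← setIntegral_eq_integral_of_forall_compl_eq_zero (s := Iic (0 : ℝ))]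
  · refine setIntegral_mono_on (φ.integrable_W _).integrableOn
      (integrableOn_exp_mul_Iic (by norm_num) 0) measurableSet_Iic fun t _ => ?_
    exact mul_le_of_le_one_left (exp_pos _).le (h t)
  · intro t ht
    simp [φ.eq_zero_of_nonneg (not_le.1 ht).le]

/-- The radial function `x ↦ φ (log ‖x‖²)`. -/
def radial (n : ℕ) (φ : NegTest) (x : EuclideanSpace ℝ (Fin n)) : ℝ :=
  (φ : ℝ → ℝ) (log (‖x‖ ^ 2))

variable {n : ℕ}

lemma exists_radial_eq_zero (φ : NegTest) : ∃ r R : ℝ, 0 < r ∧ R < 1 ∧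
    ∀ x : EuclideanSpace ℝ (Fin n), radial n φ x ≠ 0 → r ≤ ‖x‖ ∧ ‖x‖ ≤ R := by
  obtain ⟨a, b, -, hb, h⟩ := φ.exists_Ioo
  refine ⟨exp (a / 2), exp (b / 2), exp_pos _, exp_lt_one_iff.2 (by linarith), fun x hx => ?_⟩
  have hmem : log (‖x‖ ^ 2) ∈ Ioo a b := by
    by_contra hcon
    exact hx (h _ hcon)
  have hx0 : 0 < ‖x‖ := by
    rcases (norm_nonneg x).lt_or_eq with h' | h'
    · exact h'
    · exact absurd (φ.eq_zero_of_nonneg le_rfl) (by simpa [radial, ← h'] using hx)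
  rw [log_pow, Nat.cast_ofNat] at hmem
  refine ⟨?_, ?_⟩
  · rw [← le_log_iff_exp_le hx0]
    linarith [hmem.1]
  · rw [← log_le_iff_le_exp hx0]
    linarith [hmem.2]

lemma radial_eventuallyEq_zero (φ : NegTest) :
    radial n φ =ᶠ[nhds 0] fun _ => 0 := by
  obtain ⟨r, R, hr, -, h⟩ := exists_radial_eq_zero (n := n) φ
  filter_upwards [ball_mem_nhds 0 hr] with x hx
  by_contra hcon
  rw [mem_ball_zero_iff] at hx
  linarith [(h x hcon).1]

lemma contDiff_radial (φ : NegTest) : ContDiff ℝ (⊤ : ℕ∞) (radial n φ) := by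
  refine contDiff_iff_contDiffAt.2 fun x => ?_
  rcases eq_or_ne x 0 with rfl | hx
  · exact contDiffAt_const.congr_of_eventuallyEq φ.radial_eventuallyEq_zero
  · refine φ.contDiff.contDiffAt.comp x ((contDiff_norm_sq ℝ).contDiffAt.log ?_)
    exact pow_ne_zero 2 (norm_ne_zero_iff.2 hx)

lemma exists_isCompact_tsupport_radial (φ : NegTest) :
    IsCompact (tsupport (radial n φ)) ∧ tsupport (radial n φ) ⊆ ball 0 1 \ {0} := by
  obtain ⟨r, R, hr, hR, h⟩ := exists_radial_eq_zero (n := n) φ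
  have hsub : tsupport (radial n φ) ⊆ closedBall 0 R ∩ {x | r ≤ ‖x‖} := by
    refine closure_minimal (fun x hx => ?_)
      (isClosed_closedBall.inter (isClosed_le continuous_const continuous_norm))
    exact ⟨by simpa using (h x hx).2, (h x hx).1⟩
  refine ⟨(isCompact_closedBall 0 R).of_isClosed_subset (isClosed_tsupport _)
    (hsub.trans inter_subset_left), fun x hx => ⟨?_, ?_⟩⟩
  · have := (hsub hx).1
    rw [mem_closedBall_zero_iff] at this
    exact mem_ball_zero_iff.2 (this.trans_lt hR)
  · rintro rfl
    have : r ≤ ‖(0 : EuclideanSpace ℝ (Fin n))‖ := (hsub hx).2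
    rw [norm_zero] at this
    linarith

lemma pderiv1_radial (φ : NegTest) (i : Fin n) (x : EuclideanSpace ℝ (Fin n)) :
    pderiv1 i (radial n φ) x = x i * radial n ((2 : ℝ) • M (-1) (D φ)) x := by
  rcases eq_or_ne x 0 with rfl | hx
  · simp [pderiv1, φ.radial_eventuallyEq_zero.fderiv_eq]
  have hx2 : ‖x‖ ^ 2 ≠ 0 := pow_ne_zero 2 (norm_ne_zero_iff.2 hx)
  have hs : HasFDerivAt (fun y : EuclideanSpace ℝ (Fin n) => log (‖y‖ ^ 2)) _ x :=
    ((hasStrictFDerivAt_norm_sq x).hasFDerivAt).log hx2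
  have h := (φ.differentiable (log (‖x‖ ^ 2))).hasDerivAt.comp_hasFDerivAt x hs
  have h' : HasFDerivAt (radial n φ) _ x := h
  rw [pderiv1, h'.fderiv]
  have hexp : exp (-log (‖x‖ ^ 2)) = (‖x‖ ^ 2)⁻¹ := by
    rw [exp_neg, exp_log (by positivity)]
  simp [radial, hexp, EuclideanSpace.inner_single_right, -log_pow]
  ring

lemma nlap_radial (φ : NegTest) : nlap (radial n φ) = radial n (B n φ) := by
  funext x
  set φ₁ : NegTest := (2 : ℝ) • M (-1) (D φ) with hφ₁
  have hp : ∀ i : Fin n, pderiv1 i (radial n φ) = fun y => y i * radial n φ₁ y :=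
    fun i => funext fun y => pderiv1_radial φ i y
  have hpp : ∀ i : Fin n, pderiv1 i (pderiv1 i (radial n φ)) x =
      radial n φ₁ x + x i ^ 2 * radial n ((2 : ℝ) • M (-1) (D φ₁)) x := by
    intro i
    have hr : DifferentiableAt ℝ (radial n φ₁) x := (contDiff_radial φ₁).differentiable (by simp) x
    have hc : HasFDerivAt (fun y : EuclideanSpace ℝ (Fin n) => y i)
        (EuclideanSpace.proj i : EuclideanSpace ℝ (Fin n) →L[ℝ] ℝ) x :=
      (EuclideanSpace.proj i : EuclideanSpace ℝ (Fin n) →L[ℝ] ℝ).hasFDerivAt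
    have h2 := pderiv1_radial φ₁ i x
    rw [pderiv1] at h2
    have hm : HasFDerivAt (fun y : EuclideanSpace ℝ (Fin n) => y i * radial n φ₁ y) _ x :=
      hc.mul hr.hasFDerivAt
    rw [hp, pderiv1, hm.fderiv]
    simp [h2]
    ring
  rw [nlap, lap, Finset.sum_congr rfl fun i _ => hpp i, Finset.sum_add_distrib, ← Finset.sum_mul,
    ← EuclideanSpace.real_norm_sq_eq]
  rcases eq_or_ne x 0 with rfl | hx
  · simp [radial, eq_zero_of_nonneg _ le_rfl]
  have hx2 : 0 < ‖x‖ ^ 2 := by positivity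
  simp only [radial]
  set t := log (‖x‖ ^ 2)
  have hxt : ‖x‖ ^ 2 = exp t := (exp_log hx2).symm
  have he : ∀ c : ℝ, HasDerivAt (fun t => exp (c * t)) (exp (c * t) * c) t := fun c => by
    simpa using ((hasDerivAt_id t).const_mul c).exp
  have hd := (D φ).differentiable.differentiableAt.hasDerivAt (x := t)
  have hd1 : deriv (φ₁ : ℝ → ℝ) t = 2 * (exp (-1 * t) * -1 * deriv φ t +
      exp (-1 * t) * deriv (deriv φ) t) :=
    (((he (-1)).mul hd).const_mul 2).deriv
  have hd2 : deriv (M (n / 2 - 1 : ℝ) (D φ) : ℝ → ℝ) t =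
      exp ((n / 2 - 1 : ℝ) * t) * (n / 2 - 1 : ℝ) * deriv φ t +
      exp ((n / 2 - 1 : ℝ) * t) * deriv (deriv φ) t :=
    ((he (n / 2 - 1 : ℝ)).mul hd).deriv
  have e1 : exp (-(n / 2 : ℝ) * t) * exp ((n / 2 - 1 : ℝ) * t) = exp (-t) := by
    rw [← exp_add]
    ring_nf
  have e2 : exp t * exp (-t) = 1 := by
    rw [← exp_add]
    simp
  simp only [B, LinearMap.smul_apply, LinearMap.comp_apply, Submodule.coe_smul, Pi.smul_apply,
    smul_eq_mul, M_apply, D_apply, hd1, hd2, hxt, Finset.sum_const, Finset.card_univ,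
    Fintype.card_fin, nsmul_eq_mul, neg_mul, one_mul] at e1 ⊢
  simp only [hφ₁, Submodule.coe_smul, Pi.smul_apply, smul_eq_mul, M_apply, D_apply, neg_mul,
    one_mul]
  linear_combination (4 * (n / 2 - 1 : ℝ) * deriv φ t + 4 * deriv (deriv φ) t) * e1 +
    (4 * exp (-t) * deriv φ t - 4 * exp (-t) * deriv (deriv φ) t) * e2

lemma nlapIter_radial (m : ℕ) (φ : NegTest) :
    nlapIter m (radial n φ) = radial n ((B n)^[m] φ) := by
  induction m generalizing φ with
  | zero => rfl
  | succ k ih =>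
    rw [Function.iterate_succ_apply, ← ih, ← nlap_radial]
    rfl

end NegTest

/-- a distributional solution of `(-Δ)^m w = 0` on the punctured unit
ball with `w⁺ ∈ L¹` is in `L¹(B_1)`. -/
theorem stmt_8 (m n : ℕ) (hm : 0 < m) (hn : 2*m ≤ n)
    (w : EuclideanSpace ℝ (Fin n) → ℝ)
    (hw : LocallyIntegrableOn w (ball (0 : EuclideanSpace ℝ (Fin n)) 1 \ {0}))
    (hpoly : ∀ η : EuclideanSpace ℝ (Fin n) → ℝ, ContDiff ℝ (⊤ : ℕ∞) η →
      HasCompactSupport η → tsupport η ⊆ ball (0 : EuclideanSpace ℝ (Fin n)) 1 \ {0} →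
      ∫ x in ball (0 : EuclideanSpace ℝ (Fin n)) 1 \ {0}, w x * nlapIter m η x = 0)
    (hwplus : IntegrableOn (fun x => max (w x) 0)
      (ball (0 : EuclideanSpace ℝ (Fin n)) 1 \ {0})) :
    IntegrableOn w (ball (0 : EuclideanSpace ℝ (Fin n)) 1 \ {0}) := by
  set Ω : Set (EuclideanSpace ℝ (Fin n)) := ball 0 1 \ {0}
  have hΩm : MeasurableSet Ω := measurableSet_ball.diff (measurableSet_singleton 0)
  have hint : ∀ φ : NegTest, IntegrableOn (fun x => w x * NegTest.radial n φ x) Ω := by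
    intro φ
    obtain ⟨hK, hKs⟩ := NegTest.exists_isCompact_tsupport_radial (n := n) φ
    have h1 : IntegrableOn (fun x => w x * NegTest.radial n φ x) (tsupport (NegTest.radial n φ)) :=
      (hw.integrableOn_compact_subset hKs hK).mul_continuousOn
        (NegTest.contDiff_radial φ).continuous.continuousOn hK
    refine h1.of_forall_sdiff_eq_zero hΩm fun x hx => ?_
    simp [image_eq_zero_of_notMem_tsupport hx.2]
  let T : NegTest →ₗ[ℝ] ℝ :=
    { toFun := fun φ => ∫ x in Ω, w x * NegTest.radial n φ x
      map_add' := fun φ ψ => by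
        rw [← integral_add (hint φ) (hint ψ)]
        simp [NegTest.radial, mul_add]
      map_smul' := fun c φ => by
        simp [NegTest.radial, mul_left_comm, integral_const_mul] }
  obtain ⟨C, hC, hT⟩ : NegTest.WBounded (1 / 2) T := by
    refine NegTest.WBounded.of_B_pow (n := n) (by omega) m fun φ => ?_
    obtain ⟨hK, hKs⟩ := NegTest.exists_isCompact_tsupport_radial (n := n) φ
    have := hpoly (NegTest.radial n φ) (NegTest.contDiff_radial φ) hK hKs
    rwa [NegTest.nlapIter_radial] at this
  set K := ∫ t in Iic (0 : ℝ), exp (1 / 2 * t)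
  choose χ hχ0 hχ1 hχ using NegTest.exists_cutoff
  let S : ℕ → Set (EuclideanSpace ℝ (Fin n)) := fun k =>
    {x | -(k + 2 : ℝ) ≤ log (‖x‖ ^ 2)} ∩ {x | log (‖x‖ ^ 2) ≤ -(k + 1 : ℝ)⁻¹}
  have hlog : Measurable fun x : EuclideanSpace ℝ (Fin n) => log (‖x‖ ^ 2) := by fun_prop
  have hSm : ∀ k, MeasurableSet (S k) := fun k =>
    (measurableSet_le measurable_const hlog).inter (measurableSet_le hlog measurable_const)
  have hcover : AECover (volume.restrict Ω) Filter.atTop S := by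
    refine ⟨(ae_restrict_iff' hΩm).2 (.of_forall fun x hx => ?_), hSm⟩
    have hx0 : 0 < ‖x‖ := norm_pos_iff.2 hx.2
    have hx1 : ‖x‖ < 1 := mem_ball_zero_iff.1 hx.1
    have hneg : log (‖x‖ ^ 2) < 0 := log_neg (by positivity) (by nlinarith)
    have h1 : ∀ᶠ k : ℕ in Filter.atTop, -log (‖x‖ ^ 2) ≤ (k : ℝ) :=
      tendsto_natCast_atTop_atTop.eventually_ge_atTop _
    have h2 : ∀ᶠ k : ℕ in Filter.atTop, (-log (‖x‖ ^ 2))⁻¹ ≤ (k : ℝ) :=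
      tendsto_natCast_atTop_atTop.eventually_ge_atTop _
    filter_upwards [h1, h2] with k hk1 hk2
    refine ⟨show -(k + 2 : ℝ) ≤ _ by linarith, show _ ≤ -(k + 1 : ℝ)⁻¹ from ?_⟩
    have : (k + 1 : ℝ)⁻¹ ≤ -log (‖x‖ ^ 2) :=
      inv_le_of_inv_le₀ (by linarith) (hk2.trans (by linarith))
    linarith
  have hnorm : ∀ φ : NegTest, IntegrableOn (fun x => ‖w x * NegTest.radial n φ x‖) Ω :=
    fun φ => (hint φ).norm
  have hwint : ∀ k, IntegrableOn w (S k) (volume.restrict Ω) := by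
    intro k
    refine ((hint (χ k)).integrableOn (s := S k)).congr_fun (fun x hx => ?_) (hSm k)
    simp [NegTest.radial, hχ k _ hx.1 hx.2, -log_pow]
  refine hcover.integrable_of_integral_norm_bounded
    (2 * (∫ x in Ω, max (w x) 0) + C * K) hwint (.of_forall fun k => ?_)
  have h1 : ∫ x in S k, ‖w x‖ ∂(volume.restrict Ω) ≤ ∫ x in Ω, ‖w x * NegTest.radial n (χ k) x‖ := by
    rw [setIntegral_congr_fun (g := fun x => ‖w x * NegTest.radial n (χ k) x‖) (hSm k) fun x hx => by
      simp [NegTest.radial, hχ k _ hx.1 hx.2, -log_pow]]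
    exact setIntegral_le_integral (hnorm _) (.of_forall fun x => norm_nonneg _)
  have h2 : ∫ x in Ω, ‖w x * NegTest.radial n (χ k) x‖ ≤
      ∫ x in Ω, (2 * max (w x) 0 - w x * NegTest.radial n (χ k) x) := by
    refine integral_mono (hnorm _) ((hwplus.const_mul 2).sub (hint _)) fun x => ?_
    have h0 : 0 ≤ NegTest.radial n (χ k) x := hχ0 k _
    have h1 : NegTest.radial n (χ k) x ≤ 1 := hχ1 k _
    dsimp only
    rw [norm_mul, norm_eq_abs, norm_eq_abs, abs_of_nonneg h0]
    rcases le_total (w x) 0 with h | h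
    · rw [abs_of_nonpos h, max_eq_right h]
      linarith
    · rw [abs_of_nonneg h, max_eq_left h]
      nlinarith
  have h3 : |T (χ k)| ≤ C * K :=
    (hT _).trans (mul_le_mul_of_nonneg_left
      (NegTest.W_half_le _ fun t => by rw [abs_of_nonneg (hχ0 k t)]; exact hχ1 k t) hC)
  rw [integral_sub (hwplus.const_mul 2) (hint _), integral_const_mul] at h2
  have h4 : -T (χ k) ≤ C * K := (neg_le_abs _).trans h3
  exact h1.trans (h2.trans (by change _ - T (χ k) ≤ _; linarith))

end
end
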